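/- arXiv:1307.3474 — 6 statements merged into one kernel-verified Lean document; each statement's English description precedes it below -/
import Mathlib

section
/- Let p, k ≥ 1 and let A_0, …, A_{k−1} be p×p complex matrices (a Fib_p^k recurrence: A_n = 0 for all n ≥ k). Let F be the kp×kp Frobenius companion matrix whose first block row is (A_0, A_1, …, A_{k−1}), whose (i+1,i) block entries are the p×p identity matrix for i = 1, …, k−1, and whose remaining blocks are zero. Let K be the p×p matrix of polynomials with entries K(i,j) = ∑_{n=0}^{k−1} A_n(i,j) z^n. Then det(I_{kp} − z·F) = det(I_p − z·K) as polynomials in ℂ[z]. -/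
/-- The Frobenius companion matrix of the `Fib_p^k` recurrence given by the `p×p` complex
matrices `A 0, …, A (k-1)`: a `kp×kp` matrix (indexed by `Fin k × Fin p`, blocks of size
`p×p`) whose first block row is `(A 0, A 1, …, A (k-1))`, whose `(i+1, i)` block entries are
the `p×p` identity matrix, and whose remaining blocks are zero. -/
def companion (p k : ℕ) (A : ℕ → Matrix (Fin p) (Fin p) ℂ) :
    Matrix (Fin k × Fin p) (Fin k × Fin p) ℂ :=
  Matrix.of fun q r =>
    if (q.1 : ℕ) = 0 then A (r.1 : ℕ) q.2 r.2
    else if (q.1 : ℕ) = (r.1 : ℕ) + 1 ∧ q.2 = r.2 then 1 else 0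

/-- The kneading matrix of the `Fib_p^k` recurrence, a `p×p` matrix of polynomials with
entries `K(i,j) = ∑_{n=0}^{k−1} A_n(i,j) z^n`. -/
noncomputable def kneadPoly (p k : ℕ) (A : ℕ → Matrix (Fin p) (Fin p) ℂ) :
    Matrix (Fin p) (Fin p) (Polynomial ℂ) :=
  Matrix.of fun i j => ∑ n ∈ Finset.range k, Polynomial.C (A n i j) * Polynomial.X ^ n

open Polynomial in
/-- The block lower unitriangular matrix with `(i, j)` block `z^(i-j) • I` for `j ≤ i`. -/
noncomputable def powerBlock (p k : ℕ) : Matrix (Fin k × Fin p) (Fin k × Fin p) ℂ[X] :=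
  Matrix.of fun q r => if r.1 ≤ q.1 ∧ q.2 = r.2 then X ^ ((q.1 : ℕ) - (r.1 : ℕ)) else 0

theorem Matrix.det_toSquareBlock_fst {ι n R : Type*} [DecidableEq ι] [DecidableEq n]
    [Fintype ι] [Fintype n] [CommRing R] (M : Matrix (ι × n) (ι × n) R) (i : ι) :
    (M.toSquareBlock Prod.fst i).det = (Matrix.of fun a b => M (i, a) (i, b)).det := by
  let e : n ≃ {q : ι × n // q.1 = i} :=
    { toFun := fun a => ⟨(i, a), rfl⟩
      invFun := fun q => q.1.2
      left_inv := fun _ => rfl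
      right_inv := by rintro ⟨⟨_, _⟩, rfl⟩; rfl }
  rw [← Matrix.det_submatrix_equiv_self e]
  rfl

theorem det_powerBlock (p k : ℕ) : (powerBlock p k).det = 1 := by
  rw [← Matrix.det_transpose]
  have hT : (powerBlock p k).transpose.BlockTriangular Prod.fst := by
    intro q r h
    simp [powerBlock, h.not_ge]
  rw [hT.det_fintype]
  refine Finset.prod_eq_one fun i _ => ?_
  rw [Matrix.det_toSquareBlock_fst]
  convert Matrix.det_one (n := Fin p) (R := Polynomial ℂ) using 2
  ext1 a b
  simp [powerBlock, Matrix.one_apply, eq_comm]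

theorem companion_mul_powerBlock_zero (p k : ℕ) (A : ℕ → Matrix (Fin p) (Fin p) ℂ)
    (a b : Fin p) :
    ((companion p (k + 1) A).map Polynomial.C * powerBlock p (k + 1)) (0, a) (0, b) =
      kneadPoly p (k + 1) A a b := by
  simp [Matrix.mul_apply, Fintype.sum_prod_type, companion, powerBlock, kneadPoly,
    Finset.sum_range]

theorem companion_mul_powerBlock_succ (p k : ℕ) (A : ℕ → Matrix (Fin p) (Fin p) ℂ)
    (i : Fin k) (a : Fin p) (r : Fin (k + 1) × Fin p) :
    ((companion p (k + 1) A).map Polynomial.C * powerBlock p (k + 1)) (i.succ, a) r =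
      powerBlock p (k + 1) (i.castSucc, a) r := by
  rw [Matrix.mul_apply, Finset.sum_eq_single (i.castSucc, a)]
  · simp [companion]
  · rintro ⟨j, b⟩ - h
    have : ¬ ((i : ℕ) = j ∧ a = b) := by
      rintro ⟨h₁, rfl⟩
      exact h (Prod.ext (Fin.ext h₁.symm) rfl)
    simp [companion, this]
  · simp

theorem one_sub_companion_mul_powerBlock_succ (p k : ℕ) (A : ℕ → Matrix (Fin p) (Fin p) ℂ)
    (i : Fin k) (a : Fin p) (r : Fin (k + 1) × Fin p) :
    ((1 - (Polynomial.X : Polynomial ℂ) • (companion p (k + 1) A).map Polynomial.C) *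
      powerBlock p (k + 1)) (i.succ, a) r =
      (1 : Matrix (Fin (k + 1) × Fin p) (Fin (k + 1) × Fin p) (Polynomial ℂ)) (i.succ, a) r := by
  obtain ⟨j, b⟩ := r
  rw [sub_mul, one_mul, smul_mul_assoc, Matrix.sub_apply, Matrix.smul_apply,
    companion_mul_powerBlock_succ]
  simp only [powerBlock, Matrix.of_apply, Matrix.one_apply, Prod.mk.injEq, Fin.le_def,
    Fin.ext_iff, Fin.val_succ, Fin.val_castSucc, smul_eq_mul]
  by_cases hab : (a : ℕ) = b
  · rcases lt_trichotomy (j : ℕ) (i + 1) with h | h | h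
    · have h' : (j : ℕ) ≤ i := by omega
      simp [hab, h.le, h.ne', h', Nat.succ_sub h', pow_succ']
    · simp [hab, h]
    · have h' : ¬ (j : ℕ) ≤ i := by omega
      simp [hab, h.ne, h.not_ge, h']
  · simp [hab]

/-- For any `Fib_p^k` recurrence, `det(I_{kp} − z F) = det(I_p − z K)` in `ℂ[z]`. -/
theorem stmt0 (p k : ℕ) (hp : 1 ≤ p) (hk : 1 ≤ k) (A : ℕ → Matrix (Fin p) (Fin p) ℂ) :
    Matrix.det ((1 : Matrix (Fin k × Fin p) (Fin k × Fin p) (Polynomial ℂ)) -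
        (Polynomial.X : Polynomial ℂ) • (companion p k A).map Polynomial.C) =
      Matrix.det ((1 : Matrix (Fin p) (Fin p) (Polynomial ℂ)) -
        (Polynomial.X : Polynomial ℂ) • kneadPoly p k A) := by
  obtain ⟨k, rfl⟩ := Nat.exists_eq_add_of_le' hk
  rw [← mul_one (Matrix.det _), ← det_powerBlock p (k + 1), ← Matrix.det_mul]
  have hT : ((1 - (Polynomial.X : Polynomial ℂ) • (companion p (k + 1) A).map Polynomial.C) *
      powerBlock p (k + 1)).BlockTriangular Prod.fst := by
    rintro ⟨i, a⟩ r h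
    obtain ⟨i, rfl⟩ := Fin.exists_succ_eq.mpr (Fin.ne_zero_of_lt h)
    rw [one_sub_companion_mul_powerBlock_succ, Matrix.one_apply_ne]
    rintro rfl
    exact h.false
  rw [hT.det_fintype, Fin.prod_univ_succ, Finset.prod_eq_one, mul_one,
    Matrix.det_toSquareBlock_fst]
  · congr 1
    ext1 a b
    rw [Matrix.of_apply, sub_mul, one_mul, smul_mul_assoc, Matrix.sub_apply, Matrix.smul_apply,
      companion_mul_powerBlock_zero]
    simp [powerBlock, Matrix.one_apply]
  · intro i _
    rw [Matrix.det_toSquareBlock_fst]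
    convert Matrix.det_one (n := Fin p) (R := Polynomial ℂ) using 2
    ext1 a b
    rw [Matrix.of_apply, one_sub_companion_mul_powerBlock_succ]
    simp [Matrix.one_apply]
end

section
/- Let p, k ≥ 1 and let A_0, …, A_{k−1} be p×p complex matrices with Frobenius companion matrix F and kneading determinant Δ(z) = det(I_p − z·K) ∈ ℂ[z], where K(i,j) = ∑_{n=0}^{k−1} A_n(i,j) z^n. Then a nonzero complex number λ is an eigenvalue of F if and only if Δ(λ^{−1}) = 0. -/
open Matrix in
theorem companion_mulVec_zero {p m : ℕ} (A : ℕ → Matrix (Fin p) (Fin p) ℂ)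
    (w : Fin (m + 1) × Fin p → ℂ) (i : Fin p) :
    (companion p (m + 1) A *ᵥ w) (0, i) =
      ∑ n : Fin (m + 1), (A n *ᵥ fun j => w (n, j)) i := by
  simp [companion, Matrix.mulVec, dotProduct, Fintype.sum_prod_type]

open Matrix in
theorem companion_mulVec_succ {p m : ℕ} (A : ℕ → Matrix (Fin p) (Fin p) ℂ)
    (w : Fin (m + 1) × Fin p → ℂ) (n : Fin m) (i : Fin p) :
    (companion p (m + 1) A *ᵥ w) (n.succ, i) = w (n.castSucc, i) := by
  rw [Matrix.mulVec, dotProduct, Finset.sum_eq_single (n.castSucc, i)]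
  · simp [companion]
  · rintro ⟨r, j⟩ - hne
    have h : ¬ ((n : ℕ) = r ∧ i = j) := by
      rintro ⟨h₁, rfl⟩
      exact hne (Prod.ext (Fin.ext h₁.symm) rfl)
    simp [companion, h]
  · simp

/-- The value at `z` of the kneading determinant, with the powers of `z` collected. -/
theorem eval_det_one_sub_X_smul_kneadPoly (p k : ℕ) (A : ℕ → Matrix (Fin p) (Fin p) ℂ) (z : ℂ) :
    Polynomial.eval z (Matrix.det ((1 : Matrix (Fin p) (Fin p) (Polynomial ℂ)) -
      (Polynomial.X : Polynomial ℂ) • kneadPoly p k A)) =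
      Matrix.det (1 - ∑ n : Fin k, z ^ ((n : ℕ) + 1) • A n) := by
  rw [← Polynomial.coe_evalRingHom, RingHom.map_det]
  congr 1
  ext i j
  simp only [RingHom.mapMatrix_apply, Matrix.map_apply, Matrix.sub_apply, Matrix.smul_apply,
    Matrix.sum_apply, kneadPoly, Matrix.of_apply, Polynomial.coe_evalRingHom, smul_eq_mul,
    Polynomial.eval_sub, Polynomial.eval_mul, Polynomial.eval_X, Polynomial.eval_finsetSum,
    Polynomial.eval_C, Polynomial.eval_pow]
  congr 1
  · by_cases h : i = j <;> simp [Matrix.one_apply, h]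
  · rw [← Fin.sum_univ_eq_sum_range (fun n => A n i j * z ^ n), Finset.mul_sum]
    exact Finset.sum_congr rfl fun n _ => by ring

open Matrix in
/-- A vector `w` satisfies `F w = lam • w` for the companion matrix `F` exactly when it is
geometric with ratio `lam⁻¹` and its leading block is fixed by `∑ n, lam⁻¹ ^ (n + 1) • A n`. -/
theorem companion_mulVec_eq_smul_iff {p m : ℕ} (A : ℕ → Matrix (Fin p) (Fin p) ℂ) {lam : ℂ}
    (hlam : lam ≠ 0) (w : Fin (m + 1) × Fin p → ℂ) :
    companion p (m + 1) A *ᵥ w = lam • w ↔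
      (∀ n i, w (n, i) = lam⁻¹ ^ (n : ℕ) * w (0, i)) ∧
        (∑ n : Fin (m + 1), lam⁻¹ ^ ((n : ℕ) + 1) • A n) *ᵥ (fun i => w (0, i)) =
          fun i => w (0, i) := by
  have geom_row (hw : ∀ n i, w (n, i) = lam⁻¹ ^ (n : ℕ) * w (0, i)) (i : Fin p) :
      (companion p (m + 1) A *ᵥ w) (0, i) = lam *
        ((∑ n : Fin (m + 1), lam⁻¹ ^ ((n : ℕ) + 1) • A n) *ᵥ (fun i => w (0, i))) i := by
    rw [companion_mulVec_zero, Matrix.sum_mulVec, Finset.sum_apply, Finset.mul_sum]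
    refine Finset.sum_congr rfl fun n _ => ?_
    have : (fun j => w (n, j)) = lam⁻¹ ^ (n : ℕ) • fun j => w (0, j) := funext (hw n)
    rw [this, Matrix.mulVec_smul, Matrix.smul_mulVec, Pi.smul_apply, Pi.smul_apply, smul_eq_mul,
      smul_eq_mul, pow_succ]
    field_simp
  constructor
  · intro h
    have hw : ∀ n i, w (n, i) = lam⁻¹ ^ (n : ℕ) * w (0, i) := by
      intro n i
      induction n using Fin.induction with
      | zero => simp
      | succ n ih =>
        have hn := congrFun h (n.succ, i)
        rw [companion_mulVec_succ, ih, Pi.smul_apply, smul_eq_mul] at hn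
        rw [Fin.val_succ, pow_succ', mul_assoc, ← Fin.val_castSucc n, hn, inv_mul_cancel_left₀ hlam]
    refine ⟨hw, funext fun i => mul_left_cancel₀ hlam ?_⟩
    rw [← geom_row hw, h, Pi.smul_apply, smul_eq_mul]
  · rintro ⟨hw, hfix⟩
    funext ⟨n, i⟩
    rw [Pi.smul_apply, smul_eq_mul]
    cases n using Fin.cases with
    | zero => rw [geom_row hw, hfix]
    | succ n =>
      rw [companion_mulVec_succ, hw n.castSucc, hw n.succ, Fin.val_succ, pow_succ', mul_assoc,
        mul_inv_cancel_left₀ hlam, Fin.val_castSucc]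

/-- A nonzero complex number `λ` is an eigenvalue of the Frobenius companion matrix `F` of a
`Fib_p^k` recurrence if and only if the kneading determinant `Δ(z) = det(I_p − z K)`
vanishes at `λ⁻¹`. -/
theorem stmt1 (p k : ℕ) (hp : 1 ≤ p) (hk : 1 ≤ k) (A : ℕ → Matrix (Fin p) (Fin p) ℂ)
    (lam : ℂ) (hlam : lam ≠ 0) :
    (∃ w : Fin k × Fin p → ℂ, w ≠ 0 ∧ (companion p k A).mulVec w = lam • w) ↔
      Polynomial.eval lam⁻¹
        (Matrix.det ((1 : Matrix (Fin p) (Fin p) (Polynomial ℂ)) -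
          (Polynomial.X : Polynomial ℂ) • kneadPoly p k A)) = 0 := by
  obtain ⟨m, rfl⟩ : ∃ m, k = m + 1 := ⟨k - 1, by omega⟩
  rw [eval_det_one_sub_X_smul_kneadPoly, ← Matrix.exists_mulVec_eq_zero_iff]
  simp only [companion_mulVec_eq_smul_iff A hlam, Matrix.sub_mulVec, Matrix.one_mulVec,
    sub_eq_zero]
  constructor
  · rintro ⟨w, hw0, hw, hfix⟩
    refine ⟨fun i => w (0, i), fun h => hw0 ?_, hfix.symm⟩
    funext ⟨n, i⟩
    rw [hw, congrFun h i, Pi.zero_apply, mul_zero, Pi.zero_apply]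
  · rintro ⟨v, hv0, hv⟩
    refine ⟨fun q => lam⁻¹ ^ (q.1 : ℕ) * v q.2, fun h => hv0 ?_, fun n i => by simp, ?_⟩
    · funext i
      simpa using congrFun h (0, i)
    · simpa using hv.symm
end

section
/- Let p ≥ 1 and let (A_n)_{n≥0} be a Fib_p recurrence such that every entry power series K(i,j) = ∑_{n≥0} A_n(i,j) z^n has radius of convergence at least ρ for some ρ > 1, so that f(z) = det(I_p − z·K(z)) defines a holomorphic function on the disk D_ρ = {z ∈ ℂ : |z| < ρ}. Let λ_1, …, λ_m be pairwise distinct complex numbers with |λ_i| ≥ 1 such that the set of zeros of f in the closed unit disk {|z| ≤ 1} is exactly {λ_1^{−1}, …, λ_m^{−1}}, and let mul_i ≥ 1 denote the order of the zero of f at λ_i^{−1}. Then for every solution (v_n)_{n∈ℤ} = Θ(u) of the recurrence and every α ∈ {1,…,p} there exist unique complex constants c_{i,j}^{(α)} (1 ≤ i ≤ m, 1 ≤ j ≤ mul_i) such that v_n^{(α)} − ∑_{i=1}^m ∑_{j=1}^{mul_i} c_{i,j}^{(α)} · ((n+j−1)!/((j−1)!·n!)) · λ_i^n → 0 as n → ∞.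 -/
open Filter Topology

/-- The ring of power series that converge absolutely at `t`. -/
def absConvSubring (t : ℂ) : Subring (PowerSeries ℂ) where
  carrier := {φ | Summable fun n => ‖PowerSeries.coeff n φ * t ^ n‖}
  zero_mem' := by simp [summable_zero]
  one_mem' := by
    refine summable_of_ne_finset_zero (s := {0}) fun n hn => ?_
    have : n ≠ 0 := by simpa using hn
    simp [PowerSeries.coeff_one, this]
  add_mem' := by
    intro φ ψ hφ hψ
    refine Summable.of_nonneg_of_le (fun _ => norm_nonneg _) (fun n => ?_) (hφ.add hψ)
    rw [map_add, add_mul]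
    exact norm_add_le _ _
  neg_mem' := by
    intro φ hφ
    simpa using hφ
  mul_mem' := by
    intro φ ψ hφ hψ
    refine (summable_norm_sum_mul_antidiagonal_of_summable_norm hφ hψ).congr fun n => ?_
    rw [PowerSeries.coeff_mul, Finset.sum_mul]
    congr 1
    refine Finset.sum_congr rfl fun x hx => ?_
    rw [← Finset.HasAntidiagonal.mem_antidiagonal.1 hx, pow_add]
    ring

theorem mem_absConvSubring {t : ℂ} {φ : PowerSeries ℂ} :
    φ ∈ absConvSubring t ↔ Summable fun n => ‖PowerSeries.coeff n φ * t ^ n‖ := Iff.rfl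

theorem absConvSubring_anti {s t : ℂ} (h : ‖s‖ ≤ ‖t‖) : absConvSubring t ≤ absConvSubring s := by
  intro φ hφ
  rw [mem_absConvSubring] at hφ ⊢
  refine Summable.of_nonneg_of_le (fun _ => norm_nonneg _) (fun n => ?_) hφ
  simp only [norm_mul, norm_pow]
  gcongr

theorem X_mem_absConvSubring (t : ℂ) : PowerSeries.X ∈ absConvSubring t := by
  refine summable_of_ne_finset_zero (s := {1}) fun n hn => ?_
  have : n ≠ 1 := by simpa using hn
  simp [PowerSeries.coeff_X, this]

theorem C_mem_absConvSubring (t c : ℂ) : PowerSeries.C c ∈ absConvSubring t := by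
  refine summable_of_ne_finset_zero (s := {0}) fun n hn => ?_
  have : n ≠ 0 := by simpa using hn
  simp [PowerSeries.coeff_C, this]

/-- Evaluation at `z` of a power series that converges absolutely at some `t` with `‖z‖ ≤ ‖t‖`. -/
noncomputable def evalAbsConv {t z : ℂ} (h : ‖z‖ ≤ ‖t‖) : absConvSubring t →+* ℂ where
  toFun φ := ∑' n, PowerSeries.coeff n φ.1 * z ^ n
  map_zero' := by simp
  map_one' := by
    rw [tsum_eq_single 0]
    · simp
    · intro n hn
      simp [PowerSeries.coeff_one, hn]
  map_add' φ ψ := by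
    rw [← Summable.tsum_add (absConvSubring_anti h φ.2).of_norm (absConvSubring_anti h ψ.2).of_norm]
    simp [add_mul]
  map_mul' φ ψ := by
    rw [tsum_mul_tsum_eq_tsum_sum_antidiagonal_of_summable_norm
      (absConvSubring_anti h φ.2) (absConvSubring_anti h ψ.2)]
    refine tsum_congr fun n => ?_
    rw [Subring.coe_mul, PowerSeries.coeff_mul, Finset.sum_mul]
    refine Finset.sum_congr rfl fun x hx => ?_
    rw [← Finset.HasAntidiagonal.mem_antidiagonal.1 hx, pow_add]
    ring

theorem evalAbsConv_apply {t z : ℂ} (h : ‖z‖ ≤ ‖t‖) (φ : absConvSubring t) :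
    evalAbsConv h φ = ∑' n, PowerSeries.coeff n φ.1 * z ^ n := rfl

theorem evalAbsConv_X {t z : ℂ} (h : ‖z‖ ≤ ‖t‖) :
    evalAbsConv h ⟨PowerSeries.X, X_mem_absConvSubring t⟩ = z := by
  rw [evalAbsConv_apply, tsum_eq_single 1]
  · simp
  · intro n hn
    simp [PowerSeries.coeff_X, hn]

theorem evalAbsConv_C {t z : ℂ} (h : ‖z‖ ≤ ‖t‖) (c : ℂ) :
    evalAbsConv h ⟨PowerSeries.C c, C_mem_absConvSubring t c⟩ = c := by
  rw [evalAbsConv_apply, tsum_eq_single 0]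
  · simp
  · intro n hn
    simp [PowerSeries.coeff_C, hn]

theorem differentiableOn_tsum_coeff {t : ℂ} {φ : PowerSeries ℂ} (hφ : φ ∈ absConvSubring t) :
    DifferentiableOn ℂ (fun z => ∑' n, PowerSeries.coeff n φ * z ^ n) (Metric.ball 0 ‖t‖) := by
  refine Complex.differentiableOn_tsum_of_summable_norm hφ
    (fun n => by fun_prop) Metric.isOpen_ball fun n w hw => ?_
  have : ‖w‖ ≤ ‖t‖ := (mem_ball_zero_iff.1 hw).le
  simp only [norm_mul, norm_pow]
  gcongr

theorem eq_of_eventually_tsum_coeff_eq {t : ℂ} (ht : t ≠ 0) {φ ψ : PowerSeries ℂ}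
    (hφ : φ ∈ absConvSubring t) (hψ : ψ ∈ absConvSubring t)
    (h : ∀ᶠ z in 𝓝 (0 : ℂ),
      ∑' n, PowerSeries.coeff n φ * z ^ n = ∑' n, PowerSeries.coeff n ψ * z ^ n) : φ = ψ := by
  have hball : ∀ᶠ z in 𝓝 (0 : ℂ), ‖z‖ ≤ ‖t‖ := by
    filter_upwards [Metric.ball_mem_nhds (0 : ℂ) (norm_pos_iff.2 ht)] with z hz
    exact (mem_ball_zero_iff.1 hz).le
  have key : ∀ χ : PowerSeries ℂ, χ ∈ absConvSubring t →
      (∀ᶠ z in 𝓝 (0 : ℂ),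
        ∑' n, PowerSeries.coeff n χ * z ^ n = ∑' n, PowerSeries.coeff n ψ * z ^ n) →
      HasFPowerSeriesAt (fun z => ∑' n, PowerSeries.coeff n ψ * z ^ n)
        (FormalMultilinearSeries.ofScalars ℂ fun n => PowerSeries.coeff n χ) 0 := by
    intro χ hχ hχψ
    rw [hasFPowerSeriesAt_iff]
    filter_upwards [hball, hχψ] with z hz hzχ
    rw [zero_add, ← hzχ]
    have := (absConvSubring_anti hz hχ).of_norm.hasSum
    simpa [FormalMultilinearSeries.coeff_ofScalars, mul_comm] using this
  have heq := (key φ hφ h).eq_formalMultilinearSeries (key ψ hψ (Eventually.of_forall fun _ => rfl))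
  ext n
  simpa using congrArg (fun p => FormalMultilinearSeries.coeff p n) heq

/-- Taylor expansion of a holomorphic function as an absolutely convergent power series. -/
theorem exists_absConvSubring_tsum_coeff_eq {h : ℂ → ℂ} {r : ℝ} {s : ℂ} (hs : ‖s‖ < r)
    (hh : DifferentiableOn ℂ h (Metric.ball 0 r)) :
    ∃ φ ∈ absConvSubring s, ∀ z : ℂ, ‖z‖ < r → ∑' n, PowerSeries.coeff n φ * z ^ n = h z := by
  have H : ∀ z : ℂ, ‖z‖ < r → HasSum (fun n => PowerSeries.coeff n
      (PowerSeries.mk fun n => ((n.factorial : ℂ))⁻¹ * iteratedDeriv n h 0) * z ^ n) (h z) := by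
    intro z hz
    have := Complex.hasSum_taylorSeries_on_ball hh (mem_ball_zero_iff.2 hz)
    convert! this using 2 with n
    simp only [PowerSeries.coeff_mk, sub_zero, smul_eq_mul]
    ring
  exact ⟨_, (H s hs).summable.norm, fun z hz => (H z hz).tsum_eq⟩

/-- Removable singularities along a compact disk: a function which on every punctured
neighbourhood of a point of the closed unit disk agrees with an analytic function extends
holomorphically to a larger disk. -/
theorem exists_differentiableOn_ball_of_removable {q : ℂ → ℂ}
    (hq : ∀ x : ℂ, ‖x‖ ≤ 1 → ∃ k : ℂ → ℂ, AnalyticAt ℂ k x ∧ q =ᶠ[𝓝[≠] x] k) :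
    ∃ (r : ℝ) (h : ℂ → ℂ), 1 < r ∧ DifferentiableOn ℂ h (Metric.ball 0 r) ∧
      ∀ x : ℂ, ∀ k : ℂ → ℂ, AnalyticAt ℂ k x → q =ᶠ[𝓝[≠] x] k → h =ᶠ[𝓝 x] k := by
  have key : ∀ x : ℂ, ∀ k : ℂ → ℂ, AnalyticAt ℂ k x → q =ᶠ[𝓝[≠] x] k →
      (fun z => limUnder (𝓝[≠] z) q) =ᶠ[𝓝 x] k := by
    intro x k hk hqk
    have hlim : ∀ y, AnalyticAt ℂ k y → q =ᶠ[𝓝[≠] y] k → limUnder (𝓝[≠] y) q = k y :=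
      fun y hy hqy => Tendsto.limUnder_eq
        ((hy.continuousAt.tendsto.mono_left nhdsWithin_le_nhds).congr' hqy.symm)
    filter_upwards [hk.eventually_analyticAt,
      (eventually_eventually_nhds.2 (eventually_nhdsWithin_iff.1 hqk))] with y hy hqy
    refine hlim y hy ?_
    rcases eq_or_ne y x with rfl | hne
    · exact eventually_nhdsWithin_iff.2 hqy
    · refine Eventually.filter_mono nhdsWithin_le_nhds ?_
      filter_upwards [hqy, isOpen_ne.mem_nhds hne] with z hz hzx using hz hzx
  have hsub : Metric.closedBall (0 : ℂ) 1 ⊆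
      {x | AnalyticAt ℂ (fun z => limUnder (𝓝[≠] z) q) x} := by
    intro x hx
    obtain ⟨k, hk, hqk⟩ := hq x (mem_closedBall_zero_iff.1 hx)
    exact hk.congr (key x k hk hqk).symm
  obtain ⟨δ, hδ, hδs⟩ := (isCompact_closedBall (0 : ℂ) 1).exists_thickening_subset_open
    (isOpen_analyticAt ℂ _) hsub
  rw [thickening_closedBall hδ zero_le_one] at hδs
  exact ⟨δ + 1, _, by linarith,
    fun x hx => (hδs hx).differentiableAt.differentiableWithinAt, key⟩

/-- The geometric series `∑ μ ^ n X ^ n`. -/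
noncomputable def geomSeries (μ : ℂ) : PowerSeries ℂ := PowerSeries.mk fun n => μ ^ n

theorem geomSeries_eq (μ : ℂ) : geomSeries μ = 1 + PowerSeries.C μ * PowerSeries.X * geomSeries μ := by
  ext n
  rw [mul_assoc, map_add, PowerSeries.coeff_C_mul]
  cases n with
  | zero => simp [geomSeries]
  | succ n => simp [geomSeries, PowerSeries.coeff_succ_X_mul, PowerSeries.coeff_one, pow_succ']

theorem one_sub_mul_geomSeries (μ : ℂ) :
    (1 - PowerSeries.C μ * PowerSeries.X) * geomSeries μ = 1 := by
  linear_combination geomSeries_eq μ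

theorem coeff_geomSeries_pow (μ : ℂ) (j n : ℕ) :
    PowerSeries.coeff n (geomSeries μ ^ (j + 1)) =
      ((n + j).factorial : ℂ) / ((j.factorial : ℂ) * (n.factorial : ℂ)) * μ ^ n := by
  have : geomSeries μ = PowerSeries.rescale μ (PowerSeries.mk 1) := by
    ext n
    simp [geomSeries]
  rw [this, ← map_pow, PowerSeries.mk_one_pow_eq_mk_choose_add, PowerSeries.coeff_rescale,
    PowerSeries.coeff_mk, Nat.cast_add_choose, add_comm j n, mul_comm]

theorem geomSeries_mul_geomSeries {μ ν : ℂ} (h : μ ≠ ν) :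
    geomSeries μ * geomSeries ν = PowerSeries.C (μ / (μ - ν)) * geomSeries μ +
      PowerSeries.C (-ν / (μ - ν)) * geomSeries ν := by
  have hsub : μ - ν ≠ 0 := sub_ne_zero.2 h
  have h1 : PowerSeries.C (μ / (μ - ν)) + PowerSeries.C (-ν / (μ - ν)) = 1 := by
    rw [← map_add, ← map_one PowerSeries.C]
    congr 1
    field_simp
    ring
  have h2 : PowerSeries.C (μ / (μ - ν)) * PowerSeries.C ν +
      PowerSeries.C (-ν / (μ - ν)) * PowerSeries.C μ = 0 := by
    rw [← map_mul, ← map_mul, ← map_add, ← map_zero PowerSeries.C]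
    congr 1
    field_simp
    ring
  linear_combination (-(geomSeries μ * geomSeries ν)) * h1 +
    (PowerSeries.X * geomSeries μ * geomSeries ν) * h2 +
    (PowerSeries.C (μ / (μ - ν)) * geomSeries μ) * one_sub_mul_geomSeries ν +
    (PowerSeries.C (-ν / (μ - ν)) * geomSeries ν) * one_sub_mul_geomSeries μ

/-- The space of power series whose radius of convergence is larger than one. -/
def overconvergent : Submodule ℂ (PowerSeries ℂ) where
  carrier := {φ | ∃ t : ℂ, 1 < ‖t‖ ∧ φ ∈ absConvSubring t}
  zero_mem' := ⟨2, by norm_num, zero_mem _⟩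
  add_mem' := by
    rintro φ ψ ⟨s, hs, hφ⟩ ⟨t, ht, hψ⟩
    rcases le_total ‖s‖ ‖t‖ with h | h
    · exact ⟨s, hs, add_mem hφ (absConvSubring_anti h hψ)⟩
    · exact ⟨t, ht, add_mem (absConvSubring_anti h hφ) hψ⟩
  smul_mem' := by
    rintro c φ ⟨t, ht, hφ⟩
    refine ⟨t, ht, ?_⟩
    rw [PowerSeries.smul_eq_C_mul]
    exact mul_mem (C_mem_absConvSubring t c) hφ

theorem mem_overconvergent {φ : PowerSeries ℂ} :
    φ ∈ overconvergent ↔ ∃ t : ℂ, 1 < ‖t‖ ∧ φ ∈ absConvSubring t := Iff.rfl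

theorem tendsto_coeff_of_mem_overconvergent {φ : PowerSeries ℂ} (hφ : φ ∈ overconvergent) :
    Tendsto (fun n => PowerSeries.coeff n φ) atTop (𝓝 0) := by
  obtain ⟨t, ht, hφ⟩ := hφ
  have h1 : φ ∈ absConvSubring 1 := absConvSubring_anti (by simpa using ht.le) hφ
  have := (mem_absConvSubring.1 h1).of_norm.tendsto_atTop_zero
  simpa using this

/-- Division of an overconvergent power series by a linear factor whose root lies in the closed
unit disk. -/
theorem exists_overconvergent_division {μ : ℂ} (hμ : 1 ≤ ‖μ‖) {φ : PowerSeries ℂ}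
    (hφ : φ ∈ overconvergent) :
    ∃ c : ℂ, ∃ ψ ∈ overconvergent,
      φ = PowerSeries.C c + (1 - PowerSeries.C μ * PowerSeries.X) * ψ := by
  obtain ⟨t, ht, hφ⟩ := hφ
  have hμ0 : μ ≠ 0 := norm_pos_iff.1 (by linarith)
  have ht0 : 0 < ‖t‖ := by linarith
  have hinv : ‖μ⁻¹‖ ≤ 1 := by rw [norm_inv]; exact inv_le_one_of_one_le₀ hμ
  set s : ℕ → ℂ := fun n => PowerSeries.coeff n φ with hs
  obtain ⟨B, hB⟩ : ∃ B, ∀ n, ‖s n * t ^ n‖ ≤ B := by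
    refine ⟨∑' n, ‖s n * t ^ n‖, fun n => ?_⟩
    exact (mem_absConvSubring.1 hφ).le_tsum n fun _ _ => norm_nonneg _
  have hB' : ∀ n, ‖s n‖ ≤ B * ‖t‖⁻¹ ^ n := by
    intro n
    have := hB n
    rw [norm_mul, norm_pow] at this
    rw [inv_pow, ← div_eq_mul_inv, le_div_iff₀ (by positivity)]
    exact this
  have hB0 : 0 ≤ B := (norm_nonneg _).trans (hB 0)
  have htinv : ‖t‖⁻¹ < 1 := inv_lt_one_of_one_lt₀ ht
  have hbound : ∀ n j, ‖(μ⁻¹) ^ (j + 1) * s (n + 1 + j)‖ ≤ B * ‖t‖⁻¹ ^ n * ‖t‖⁻¹ ^ j := by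
    intro n j
    rw [norm_mul, norm_pow]
    calc ‖μ⁻¹‖ ^ (j + 1) * ‖s (n + 1 + j)‖ ≤ 1 * (B * ‖t‖⁻¹ ^ (n + 1 + j)) := by
          gcongr
          · exact pow_le_one₀ (norm_nonneg _) hinv
          · exact hB' _
      _ ≤ B * ‖t‖⁻¹ ^ n * ‖t‖⁻¹ ^ j := by
          rw [one_mul, mul_assoc, ← pow_add]
          gcongr 1
          exact pow_le_pow_of_le_one (by positivity) htinv.le (by omega)
  have hgeom : Summable fun j : ℕ => ‖t‖⁻¹ ^ j :=
    summable_geometric_of_lt_one (by positivity) htinv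
  have hsum : ∀ n, Summable fun j => (μ⁻¹) ^ (j + 1) * s (n + 1 + j) := fun n =>
    Summable.of_norm_bounded (hgeom.mul_left _) (hbound n)
  set d : ℕ → ℂ := fun n => -∑' j, (μ⁻¹) ^ (j + 1) * s (n + 1 + j) with hd
  have hdn : ∀ n, ‖d n‖ ≤ B * (∑' j : ℕ, ‖t‖⁻¹ ^ j) * ‖t‖⁻¹ ^ n := by
    intro n
    rw [hd, norm_neg]
    calc _ ≤ ∑' j : ℕ, B * ‖t‖⁻¹ ^ n * ‖t‖⁻¹ ^ j :=
          tsum_of_norm_bounded (hgeom.mul_left _).hasSum (hbound n)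
      _ = _ := by rw [tsum_mul_left]; ring
  have hrec : ∀ n, μ * d n = d (n + 1) - s (n + 1) := by
    intro n
    simp only [hd]
    rw [(hsum n).tsum_eq_zero_add, mul_neg, mul_add, ← tsum_mul_left]
    have : ∀ j, μ * (μ⁻¹ ^ (j + 1 + 1) * s (n + 1 + (j + 1))) =
        μ⁻¹ ^ (j + 1) * s (n + 1 + 1 + j) := by
      intro j
      rw [pow_succ _ (j + 1), show n + 1 + (j + 1) = n + 1 + 1 + j by omega]
      field_simp
    simp only [this]
    simp only [zero_add, pow_one, add_zero]
    field_simp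
    ring
  refine ⟨s 0 - d 0, PowerSeries.mk d, ?_, ?_⟩
  · obtain ⟨r, hr1, hrt⟩ := exists_between ht
    have hr0 : 0 < r := by linarith
    refine ⟨(r : ℂ), by simpa [abs_of_pos hr0] using hr1, ?_⟩
    rw [mem_absConvSubring]
    have : Summable fun n : ℕ => B * (∑' j : ℕ, ‖t‖⁻¹ ^ j) * (‖t‖⁻¹ * r) ^ n := by
      refine (summable_geometric_of_lt_one (by positivity) ?_).mul_left _
      rw [inv_mul_lt_iff₀ ht0]
      linarith
    refine Summable.of_nonneg_of_le (fun _ => norm_nonneg _) (fun n => ?_) this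
    rw [PowerSeries.coeff_mk, norm_mul, norm_pow, Complex.norm_real, Real.norm_of_nonneg hr0.le,
      mul_pow, ← mul_assoc]
    gcongr
    exact hdn n
  · ext n
    rw [sub_mul, one_mul, mul_assoc, map_add, map_sub (PowerSeries.coeff n), PowerSeries.coeff_C_mul]
    cases n with
    | zero => simp [hs]
    | succ n =>
      rw [PowerSeries.coeff_succ_X_mul, PowerSeries.coeff_mk, PowerSeries.coeff_mk, hrec,
        PowerSeries.coeff_C, if_neg n.succ_ne_zero]
      simp [hs]

/-- The power series that are, up to an overconvergent one, combinations of the principal parts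
`(1 - μ X)⁻ʲ` with `1 ≤ j ≤ s.count μ`. -/
noncomputable def principalPartSpace (s : Multiset ℂ) : Submodule ℂ (PowerSeries ℂ) :=
  Submodule.span ℂ {φ | ∃ μ : ℂ, ∃ j < s.count μ, φ = geomSeries μ ^ (j + 1)} ⊔ overconvergent

theorem geomSeries_pow_mem_principalPartSpace {s : Multiset ℂ} {μ : ℂ} {j : ℕ}
    (h : j < s.count μ) : geomSeries μ ^ (j + 1) ∈ principalPartSpace s :=
  Submodule.mem_sup_left (Submodule.subset_span ⟨μ, j, h, rfl⟩)

theorem geomSeries_mul_mem_principalPartSpace {s : Multiset ℂ} {μ : ℂ} (hμ : 1 ≤ ‖μ‖)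
    {φ : PowerSeries ℂ} (hφ : φ ∈ principalPartSpace s) :
    geomSeries μ * φ ∈ principalPartSpace (μ ::ₘ s) := by
  have hself : geomSeries μ ∈ principalPartSpace (μ ::ₘ s) := by
    simpa using geomSeries_pow_mem_principalPartSpace (s := μ ::ₘ s) (μ := μ) (j := 0) (by simp)
  have hsmul : ∀ (c : ℂ) (ψ : PowerSeries ℂ), ψ ∈ principalPartSpace (μ ::ₘ s) →
      PowerSeries.C c * ψ ∈ principalPartSpace (μ ::ₘ s) := by
    intro c ψ hψ
    rw [← PowerSeries.smul_eq_C_mul]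
    exact Submodule.smul_mem _ _ hψ
  suffices principalPartSpace s ≤
      (principalPartSpace (μ ::ₘ s)).comap (LinearMap.mulLeft ℂ (geomSeries μ)) from this hφ
  refine sup_le (Submodule.span_le.2 ?_) ?_
  · rintro _ ⟨ν, j, hj, rfl⟩
    change geomSeries μ * geomSeries ν ^ (j + 1) ∈ principalPartSpace (μ ::ₘ s)
    rcases eq_or_ne μ ν with rfl | hne
    · rw [← pow_succ']
      exact geomSeries_pow_mem_principalPartSpace (by simpa using hj)
    · have hν : ∀ i ≤ j, geomSeries ν ^ (i + 1) ∈ principalPartSpace (μ ::ₘ s) := fun i hi =>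
        geomSeries_pow_mem_principalPartSpace
          ((hi.trans_lt hj).trans_le (Multiset.count_le_count_cons ν μ s))
      suffices ∀ i ≤ j, geomSeries μ * geomSeries ν ^ (i + 1) ∈ principalPartSpace (μ ::ₘ s) from
        this j le_rfl
      intro i
      induction i with
      | zero =>
        intro h0
        rw [zero_add, pow_one, geomSeries_mul_geomSeries hne]
        exact add_mem (hsmul _ _ hself) (hsmul _ _ (by simpa using hν 0 h0))
      | succ i ih =>
        intro hi
        have : geomSeries μ * geomSeries ν ^ (i + 1 + 1) =
            PowerSeries.C (μ / (μ - ν)) * (geomSeries μ * geomSeries ν ^ (i + 1)) +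
              PowerSeries.C (-ν / (μ - ν)) * geomSeries ν ^ (i + 1 + 1) := by
          linear_combination geomSeries ν ^ (i + 1) * geomSeries_mul_geomSeries hne
        rw [this]
        exact add_mem (hsmul _ _ (ih (by omega))) (hsmul _ _ (hν _ hi))
  · intro ψ hψ
    change geomSeries μ * ψ ∈ principalPartSpace (μ ::ₘ s)
    obtain ⟨c, χ, hχ, rfl⟩ := exists_overconvergent_division hμ hψ
    have : geomSeries μ * (PowerSeries.C c + (1 - PowerSeries.C μ * PowerSeries.X) * χ) =
        PowerSeries.C c * geomSeries μ + χ := by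
      linear_combination χ * one_sub_mul_geomSeries μ
    rw [this]
    exact add_mem (hsmul _ _ hself) (Submodule.mem_sup_right hχ)

/-- Partial fraction decomposition modulo overconvergent power series. -/
theorem mem_principalPartSpace_of_mul_mem {s : Multiset ℂ} (hs : ∀ μ ∈ s, 1 ≤ ‖μ‖)
    {φ : PowerSeries ℂ}
    (h : (s.map fun μ => 1 - PowerSeries.C μ * PowerSeries.X).prod * φ ∈ overconvergent) :
    φ ∈ principalPartSpace s := by
  induction s using Multiset.induction_on generalizing φ with
  | empty => exact Submodule.mem_sup_right (by simpa using h)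
  | cons μ s ih =>
    rw [Multiset.map_cons, Multiset.prod_cons, mul_comm (1 - _), mul_assoc] at h
    have := geomSeries_mul_mem_principalPartSpace (hs μ (Multiset.mem_cons_self μ s))
      (ih (fun ν hν => hs ν (Multiset.mem_cons_of_mem hν)) h)
    rwa [← mul_assoc, mul_comm (geomSeries μ), one_sub_mul_geomSeries, one_mul] at this

theorem tendsto_coeff_polynomial_mul {φ : PowerSeries ℂ}
    (hφ : Tendsto (fun n => PowerSeries.coeff n φ) atTop (𝓝 0)) (P : Polynomial ℂ) :
    Tendsto (fun n => PowerSeries.coeff n ((P : PowerSeries ℂ) * φ)) atTop (𝓝 0) := by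
  induction P using Polynomial.induction_on' with
  | add P Q hP hQ => simpa [add_mul] using hP.add hQ
  | monomial k c =>
    rw [← tendsto_add_atTop_iff_nat k]
    simpa [Polynomial.coe_monomial, PowerSeries.monomial_eq_C_mul_X_pow, mul_assoc,
      PowerSeries.coeff_X_pow_mul] using hφ.const_mul c

theorem tendsto_coeff_polynomial (P : Polynomial ℂ) :
    Tendsto (fun n => PowerSeries.coeff n (P : PowerSeries ℂ)) atTop (𝓝 0) := by
  have h1 : Tendsto (fun n => PowerSeries.coeff n (1 : PowerSeries ℂ)) atTop (𝓝 0) := by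
    refine tendsto_const_nhds.congr' ?_
    filter_upwards [eventually_ne_atTop 0] with n hn
    simp [PowerSeries.coeff_one, hn]
  simpa using tendsto_coeff_polynomial_mul h1 P

theorem eval_eq_zero_of_tendsto_coeff_mul_geomSeries {μ : ℂ} (hμ : 1 ≤ ‖μ‖) (P : Polynomial ℂ)
    (h : Tendsto (fun n => PowerSeries.coeff n ((P : PowerSeries ℂ) * geomSeries μ)) atTop (𝓝 0)) :
    P.eval μ⁻¹ = 0 := by
  have hμ0 : μ ≠ 0 := norm_pos_iff.1 (by linarith)
  obtain ⟨Q, hQ⟩ := Polynomial.X_sub_C_dvd_sub_C_eval (p := P) (a := μ⁻¹)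
  have hP : P = Polynomial.C (P.eval μ⁻¹) +
      (1 - Polynomial.C μ * Polynomial.X) * (Polynomial.C (-μ⁻¹) * Q) := by
    have hC : (Polynomial.C μ * Polynomial.C μ⁻¹ : Polynomial ℂ) = 1 := by
      rw [← map_mul, mul_inv_cancel₀ hμ0, map_one]
    rw [map_neg]
    linear_combination hQ - Polynomial.X * Q * hC
  have hmul : (P : PowerSeries ℂ) * geomSeries μ = PowerSeries.C (P.eval μ⁻¹) * geomSeries μ +
      ((Polynomial.C (-μ⁻¹) * Q : Polynomial ℂ) : PowerSeries ℂ) := by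
    conv_lhs => rw [hP]
    have := one_sub_mul_geomSeries μ
    push_cast
    linear_combination (PowerSeries.C (-μ⁻¹) * (Q : PowerSeries ℂ)) * this
  rw [hmul] at h
  have h2 := h.sub (tendsto_coeff_polynomial (Polynomial.C (-μ⁻¹) * Q))
  simp only [map_add, add_sub_cancel_right, sub_zero, PowerSeries.coeff_C_mul, geomSeries,
    PowerSeries.coeff_mk] at h2
  have h3 := h2.norm
  rw [norm_zero] at h3
  have h4 : ‖P.eval μ⁻¹‖ ≤ 0 := by
    refine ge_of_tendsto' h3 fun n => ?_
    rw [norm_mul, norm_pow]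
    exact le_mul_of_one_le_right (norm_nonneg _) (one_le_pow₀ hμ)
  exact norm_le_zero_iff.1 h4

/-- Principal parts with poles in the closed unit disk are linearly independent modulo power
series whose coefficients tend to zero. -/
theorem eq_zero_of_tendsto_coeff_sum_geomSeries {m : ℕ} {lam : Fin m → ℂ}
    (hinj : Function.Injective lam) (hdom : ∀ i, 1 ≤ ‖lam i‖) {mul : Fin m → ℕ}
    (d : (i : Fin m) → Fin (mul i) → ℂ)
    (h : Tendsto (fun n => PowerSeries.coeff n (∑ i, ∑ j : Fin (mul i),
      PowerSeries.C (d i j) * geomSeries (lam i) ^ ((j : ℕ) + 1))) atTop (𝓝 0)) : d = 0 := by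
  by_contra hne
  obtain ⟨i₀, hi₀⟩ := Function.ne_iff.1 hne
  obtain ⟨j₁, hj₁⟩ := Function.ne_iff.1 hi₀
  obtain ⟨J, hJ, hmax⟩ := (Finset.univ.filter fun j => d i₀ j ≠ 0).exists_max_image id
    ⟨j₁, by simpa using hj₁⟩
  have hJ0 : d i₀ J ≠ 0 := by simpa using hJ
  have hJmax : ∀ j, J < j → d i₀ j = 0 := by
    intro j hj
    by_contra hdj
    exact absurd (hmax j (by simpa using hdj)) (not_le.2 hj)
  obtain ⟨L, hL⟩ : ∃ L : Fin m → Polynomial ℂ,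
      L = fun i => 1 - Polynomial.C (lam i) * Polynomial.X := ⟨_, rfl⟩
  have hlin : ∀ i, (L i : PowerSeries ℂ) * geomSeries (lam i) = 1 := by
    intro i
    simpa [hL] using one_sub_mul_geomSeries (lam i)
  have hpow : ∀ i k l, (L i : PowerSeries ℂ) ^ (l + k) * geomSeries (lam i) ^ k =
      (L i : PowerSeries ℂ) ^ l := by
    intro i k l
    rw [pow_add, mul_assoc, ← mul_pow, hlin, one_pow, mul_one]
  set N : Polynomial ℂ := ∏ i ∈ Finset.univ.erase i₀, L i ^ mul i with hN
  have hNeval : N.eval (lam i₀)⁻¹ ≠ 0 := by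
    rw [hN, Polynomial.eval_prod, Finset.prod_ne_zero_iff]
    intro i hi
    have hi' : i ≠ i₀ := (Finset.mem_erase.1 hi).1
    have h0 : lam i₀ ≠ 0 := norm_pos_iff.1 (by linarith [hdom i₀])
    rw [Polynomial.eval_pow]
    refine pow_ne_zero _ ?_
    simp only [hL, Polynomial.eval_sub, Polynomial.eval_one, Polynomial.eval_mul,
      Polynomial.eval_C, Polynomial.eval_X]
    intro h1
    refine hi' (hinj ?_)
    field_simp at h1
    linear_combination -h1
  have hterm : ∀ i, ∀ j : Fin (mul i), (⟨i, j⟩ : Σ i, Fin (mul i)) ≠ ⟨i₀, J⟩ →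
      Tendsto (fun n => PowerSeries.coeff n (((N * L i₀ ^ (J : ℕ) : Polynomial ℂ) :
        PowerSeries ℂ) * (PowerSeries.C (d i j) * geomSeries (lam i) ^ ((j : ℕ) + 1))))
        atTop (𝓝 0) := by
    intro i j hij
    suffices ∃ Q : Polynomial ℂ, ((N * L i₀ ^ (J : ℕ) : Polynomial ℂ) :
        PowerSeries ℂ) * (PowerSeries.C (d i j) * geomSeries (lam i) ^ ((j : ℕ) + 1)) = Q by
      obtain ⟨Q, hQ⟩ := this
      rw [hQ]
      exact tendsto_coeff_polynomial Q
    rcases eq_or_ne i i₀ with rfl | hi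
    · rcases lt_trichotomy j J with hlt | rfl | hgt
      · obtain ⟨l, hl⟩ : ∃ l, (J : ℕ) = l + ((j : ℕ) + 1) :=
          ⟨J - (j + 1), by have : (j : ℕ) < J := hlt; omega⟩
        refine ⟨N * Polynomial.C (d i j) * L i ^ l, ?_⟩
        have := hpow i (j + 1) l
        rw [hl]
        push_cast
        linear_combination ((N : PowerSeries ℂ) * PowerSeries.C (d i j)) * this
      · exact absurd rfl hij
      · exact ⟨0, by simp [hJmax j hgt]⟩
    · obtain ⟨l, hl⟩ : ∃ l, mul i = l + ((j : ℕ) + 1) := ⟨mul i - (j + 1), by omega⟩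
      have hNi : N = L i ^ (l + ((j : ℕ) + 1)) * ∏ k ∈ (Finset.univ.erase i₀).erase i, L k ^ mul k := by
        rw [← hl]
        exact (Finset.mul_prod_erase _ (fun k => L k ^ mul k) (by simp [hi])).symm
      refine ⟨L i ^ l * Polynomial.C (d i j) * L i₀ ^ (J : ℕ) *
        ∏ k ∈ (Finset.univ.erase i₀).erase i, L k ^ mul k, ?_⟩
      have := hpow i (j + 1) l
      rw [hNi]
      generalize ∏ k ∈ (Finset.univ.erase i₀).erase i, L k ^ mul k = M
      push_cast
      linear_combination (PowerSeries.C (d i j) * (L i₀ : PowerSeries ℂ) ^ (J : ℕ) *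
        (M : PowerSeries ℂ)) * this
  have htot := tendsto_coeff_polynomial_mul h (N * L i₀ ^ (J : ℕ))
  rw [← Fintype.sum_sigma' (fun i (j : Fin (mul i)) =>
    PowerSeries.C (d i j) * geomSeries (lam i) ^ ((j : ℕ) + 1)), Finset.mul_sum,
    ← Finset.add_sum_erase _ _ (Finset.mem_univ (⟨i₀, J⟩ : Σ i, Fin (mul i)))] at htot
  have hrest := tendsto_finsetSum (Finset.univ.erase (⟨i₀, J⟩ : Σ i, Fin (mul i)))
    fun x hx => hterm x.1 x.2 (Finset.mem_erase.1 hx).1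
  simp only [Finset.sum_const_zero] at hrest
  have hmain := htot.sub hrest
  simp only [map_add, map_sum, add_sub_cancel_right, sub_zero] at hmain
  have heq : ((N * L i₀ ^ (J : ℕ) : Polynomial ℂ) : PowerSeries ℂ) *
      (PowerSeries.C (d i₀ J) * geomSeries (lam i₀) ^ ((J : ℕ) + 1)) =
      ((Polynomial.C (d i₀ J) * N : Polynomial ℂ) : PowerSeries ℂ) * geomSeries (lam i₀) := by
    have := hpow i₀ J 0
    push_cast
    linear_combination ((N : PowerSeries ℂ) * PowerSeries.C (d i₀ J) * geomSeries (lam i₀)) * this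
  rw [heq] at hmain
  have := eval_eq_zero_of_tendsto_coeff_mul_geomSeries (hdom i₀) _ hmain
  rw [Polynomial.eval_mul, Polynomial.eval_C] at this
  exact mul_ne_zero hJ0 hNeval this

theorem mk_add_mem_absConvSubring {t : ℂ} (ht : t ≠ 0) {a : ℕ → ℂ}
    (ha : PowerSeries.mk a ∈ absConvSubring t) (k : ℕ) :
    (PowerSeries.mk fun n => a (n + k)) ∈ absConvSubring t := by
  have h1 : Summable fun n => ‖a n * t ^ n‖ := by simpa [mem_absConvSubring] using ha
  have h2 := ((summable_nat_add_iff k).2 h1).mul_right ‖(t ^ k)⁻¹‖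
  rw [mem_absConvSubring]
  refine h2.congr fun n => ?_
  rw [PowerSeries.coeff_mk, ← norm_mul, pow_add]
  congr 1
  field_simp

/-- The generating function `V` of a solution satisfies `V - X K V ∈ absConvSubring t` whenever
the kneading matrix `K` converges absolutely at `t`. -/
theorem sub_X_mul_sum_mem_absConvSubring {p : ℕ} {A : ℕ → Matrix (Fin p) (Fin p) ℂ}
    {t : ℂ} (ht : t ≠ 0)
    (hA : ∀ i j, (PowerSeries.mk fun n => A n i j) ∈ absConvSubring t)
    {v : ℤ → Fin p → ℂ} (hsupp : {n : ℤ | n < 0 ∧ v n ≠ 0}.Finite)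
    (hrec : ∀ n : ℕ, v ((n : ℤ) + 1) = ∑' i : ℕ, (A i).mulVec (v ((n : ℤ) - (i : ℤ))))
    (i : Fin p) :
    (PowerSeries.mk fun n : ℕ => v n i) - PowerSeries.X * ∑ j,
      (PowerSeries.mk fun n => A n i j) * (PowerSeries.mk fun n : ℕ => v n j) ∈
        absConvSubring t := by
  obtain ⟨N, hN⟩ : ∃ N : ℕ, ∀ k : ℤ, (N : ℤ) < k → v (-k) = 0 := by
    obtain ⟨b, hb⟩ := hsupp.bddBelow
    refine ⟨b.natAbs, fun k hk => ?_⟩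
    by_contra hne
    have : b ≤ -k := hb ⟨by omega, hne⟩
    omega
  have hsum : ∀ n : ℕ, v ((n : ℤ) + 1) i =
      (∑ l ∈ Finset.range (n + 1), ∑ j, A l i j * v ((n - l : ℕ) : ℤ) j) +
        ∑ k ∈ Finset.range N, ∑ j, A (n + (k + 1)) i j * v (-((k : ℤ) + 1)) j := by
    intro n
    rw [hrec, tsum_eq_sum (s := Finset.range (n + 1 + N)), Finset.sum_range_add,
      Pi.add_apply, Finset.sum_apply, Finset.sum_apply]
    · congr 1
      · refine Finset.sum_congr rfl fun l hl => ?_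
        have hl' : l ≤ n := Nat.lt_succ_iff.1 (Finset.mem_range.1 hl)
        rw [Nat.cast_sub hl']
        rfl
      · refine Finset.sum_congr rfl fun k _ => ?_
        rw [show n + 1 + k = n + (k + 1) by omega,
          show (n : ℤ) - ((n + (k + 1) : ℕ) : ℤ) = -((k : ℤ) + 1) by push_cast; ring]
        rfl
    · intro l hl
      have hl' : n + 1 + N ≤ l := by simpa using hl
      rw [show (n : ℤ) - (l : ℤ) = -((l : ℤ) - n) by ring, hN _ (by omega), Matrix.mulVec_zero]
  have heq : (PowerSeries.mk fun n : ℕ => v n i) - PowerSeries.X * ∑ j,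
      (PowerSeries.mk fun n => A n i j) * (PowerSeries.mk fun n : ℕ => v n j) =
      PowerSeries.C (v 0 i) + PowerSeries.X * ∑ k ∈ Finset.range N, ∑ j,
        (PowerSeries.mk fun n => A (n + (k + 1)) i j) *
          PowerSeries.C (v (-((k : ℤ) + 1)) j) := by
    ext n
    cases n with
    | zero => simp
    | succ n =>
      rw [map_sub, map_add, PowerSeries.coeff_succ_X_mul, PowerSeries.coeff_succ_X_mul,
        PowerSeries.coeff_mk, Nat.cast_succ, hsum, PowerSeries.coeff_C, if_neg n.succ_ne_zero,
        map_sum, map_sum]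
      simp only [map_sum, PowerSeries.coeff_mul_C, PowerSeries.coeff_mk]
      simp only [PowerSeries.coeff_mul, PowerSeries.coeff_mk]
      rw [Finset.sum_comm (s := Finset.range (n + 1))]
      have : ∀ j, ∑ x ∈ Finset.HasAntidiagonal.antidiagonal n, A x.1 i j * v (x.2 : ℤ) j =
          ∑ l ∈ Finset.range (n + 1), A l i j * v ((n - l : ℕ) : ℤ) j := fun j =>
        Finset.Nat.sum_antidiagonal_eq_sum_range_succ (fun a b => A a i j * v (b : ℤ) j) n
      simp only [this]
      ring
  rw [heq]
  refine add_mem (C_mem_absConvSubring _ _) (mul_mem (X_mem_absConvSubring _)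
    (sum_mem fun k _ => sum_mem fun j _ => mul_mem ?_ (C_mem_absConvSubring _ _)))
  exact mk_add_mem_absConvSubring ht (hA i j) (k + 1)

/-- The kneading determinant as a power series: it evaluates to `det (1 - z K(z))`, and it clears
the denominator of the generating function of any solution. -/
theorem exists_kneadingDeterminant {p : ℕ} {A : ℕ → Matrix (Fin p) (Fin p) ℂ}
    {t : ℂ} (ht : t ≠ 0)
    (hA : ∀ i j, (PowerSeries.mk fun n => A n i j) ∈ absConvSubring t) :
    ∃ F ∈ absConvSubring t,
      (∀ z : ℂ, ‖z‖ ≤ ‖t‖ → ∑' n, PowerSeries.coeff n F * z ^ n =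
        Matrix.det (1 - z • Matrix.of fun i j : Fin p => ∑' n : ℕ, A n i j * z ^ n)) ∧
      ∀ v : ℤ → Fin p → ℂ, {n : ℤ | n < 0 ∧ v n ≠ 0}.Finite →
        (∀ n : ℕ, v ((n : ℤ) + 1) = ∑' i : ℕ, (A i).mulVec (v ((n : ℤ) - (i : ℤ)))) →
        ∀ a, F * (PowerSeries.mk fun n : ℕ => v n a) ∈ absConvSubring t := by
  let K : Matrix (Fin p) (Fin p) (absConvSubring t) :=
    Matrix.of fun i j => ⟨PowerSeries.mk fun n => A n i j, hA i j⟩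
  let M : Matrix (Fin p) (Fin p) (absConvSubring t) :=
    1 - (⟨PowerSeries.X, X_mem_absConvSubring t⟩ : absConvSubring t) • K
  refine ⟨M.det.1, M.det.2, fun z hz => ?_, fun v hsupp hrec a => ?_⟩
  · rw [← evalAbsConv_apply hz, RingHom.map_det]
    congr 1
    rw [map_sub, map_one]
    congr 1
    ext i j
    simp only [RingHom.mapMatrix_apply, Matrix.map_apply, Matrix.smul_apply, smul_eq_mul, map_mul,
      evalAbsConv_X, Matrix.of_apply, K]
    simp only [evalAbsConv_apply, PowerSeries.coeff_mk]
  · let V : Fin p → PowerSeries ℂ := fun i => PowerSeries.mk fun n : ℕ => v n i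
    let M₀ : Matrix (Fin p) (Fin p) (PowerSeries ℂ) := (absConvSubring t).subtype.mapMatrix M
    have hMV : ∀ i, (M₀.mulVec V) i ∈ absConvSubring t := by
      intro i
      have : M₀ = 1 - (PowerSeries.X : PowerSeries ℂ) •
          Matrix.of fun i j => PowerSeries.mk fun n => A n i j := by
        simp only [M₀, M]
        rw [map_sub, map_one]
        congr 1
      rw [this, Matrix.sub_mulVec, Matrix.one_mulVec, Matrix.smul_mulVec]
      exact sub_X_mul_sum_mem_absConvSubring ht hA hsupp hrec i
    have hdet : (M.det : PowerSeries ℂ) = M₀.det := RingHom.map_det (absConvSubring t).subtype M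
    have hadj : M₀.adjugate.mulVec (M₀.mulVec V) a = M₀.det * V a := by
      rw [Matrix.mulVec_mulVec, Matrix.adjugate_mul, Matrix.smul_mulVec, Matrix.one_mulVec]
      rfl
    have hmem : ∀ i j, M₀.adjugate i j ∈ absConvSubring t := by
      intro i j
      have := RingHom.map_adjugate (absConvSubring t).subtype M
      change ((absConvSubring t).subtype.mapMatrix M).adjugate i j ∈ _
      rw [← this]
      exact (M.adjugate i j).2
    rw [hdet]
    change M₀.det * V a ∈ _
    rw [← hadj]
    exact sum_mem fun j _ => mul_mem (hmem a j) (hMV j)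

/-- If the power series `F` has the zeros `λᵢ⁻¹` of order `mul i`, and no others, in the closed unit
disk, then `∏ (1 - λᵢ X) ^ mul i` is an overconvergent multiple of `F`. -/
theorem exists_mul_eq_prod_one_sub_pow {t : ℂ} (ht : 1 < ‖t‖) {F : PowerSeries ℂ}
    (hF : F ∈ absConvSubring t) {f : ℂ → ℂ}
    (hfF : ∀ z : ℂ, ‖z‖ ≤ ‖t‖ → ∑' n, PowerSeries.coeff n F * z ^ n = f z)
    (hf0 : f 0 ≠ 0) {m : ℕ} {lam : Fin m → ℂ} (hdom : ∀ i, 1 ≤ ‖lam i‖)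
    (hzeros : ∀ z : ℂ, ‖z‖ ≤ 1 → f z = 0 → ∃ i, z = (lam i)⁻¹) {mul : Fin m → ℕ}
    (hord : ∀ i, ∃ g : ℂ → ℂ, AnalyticAt ℂ g (lam i)⁻¹ ∧ g (lam i)⁻¹ ≠ 0 ∧
      ∀ᶠ z in 𝓝 (lam i)⁻¹, f z = (z - (lam i)⁻¹) ^ (mul i) * g z) :
    ∃ s : ℂ, 1 < ‖s‖ ∧ ‖s‖ ≤ ‖t‖ ∧ ∃ φ ∈ absConvSubring s,
      φ * F = ∏ i, (1 - PowerSeries.C (lam i) * PowerSeries.X) ^ mul i := by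
  have hfan : ∀ x : ℂ, ‖x‖ < ‖t‖ → AnalyticAt ℂ f x := by
    intro x hx
    have hd : DifferentiableOn ℂ f (Metric.ball 0 ‖t‖) :=
      (differentiableOn_tsum_coeff hF).congr fun z hz => (hfF z (mem_ball_zero_iff.1 hz).le).symm
    exact hd.analyticAt (Metric.isOpen_ball.mem_nhds (mem_ball_zero_iff.2 hx))
  set P : ℂ → ℂ := fun z => ∏ i, (1 - lam i * z) ^ mul i with hP
  have hPan : ∀ x, AnalyticAt ℂ P x := by
    intro x
    have : Differentiable ℂ P := by fun_prop
    exact this.analyticAt x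
  have hquot : ∀ x, ‖x‖ < ‖t‖ → f x ≠ 0 → AnalyticAt ℂ (fun z => P z / f z) x :=
    fun x hx hfx => (hPan x).div (hfan x hx) hfx
  obtain ⟨r, h, hr, hh, hloc⟩ := exists_differentiableOn_ball_of_removable
    (q := fun z => P z / f z) (by
      intro x hx
      by_cases hfx : f x = 0
      · obtain ⟨i, rfl⟩ := hzeros x hx hfx
        obtain ⟨g, hg, hg0, hfg⟩ := hord i
        have hi0 : lam i ≠ 0 := norm_pos_iff.1 (by linarith [hdom i])
        refine ⟨fun z => ((-lam i) ^ mul i * ∏ k ∈ Finset.univ.erase i,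
          (1 - lam k * z) ^ mul k) / g z, ?_, ?_⟩
        · refine AnalyticAt.div ?_ hg hg0
          exact Differentiable.analyticAt (by fun_prop) _
        · refine eventually_nhdsWithin_iff.2 ?_
          filter_upwards [hfg] with z hz hne
          have hne' : z - (lam i)⁻¹ ≠ 0 := sub_ne_zero.2 hne
          have hfac : 1 - lam i * z = -lam i * (z - (lam i)⁻¹) := by
            field_simp
            ring
          simp only [hP]
          rw [hz, ← Finset.mul_prod_erase _ _ (Finset.mem_univ i), hfac, mul_pow,
            mul_comm ((-lam i) ^ mul i), mul_assoc, mul_div_mul_left _ _ (pow_ne_zero _ hne')]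
      · exact ⟨_, hquot x (by linarith) hfx, EventuallyEq.rfl⟩)
  obtain ⟨σ, hσ1, hσ⟩ := exists_between (lt_min hr ht)
  have hσ0 : 0 < σ := by linarith
  have hnorm : ‖(σ : ℂ)‖ = σ := by rw [Complex.norm_real, Real.norm_of_nonneg hσ0.le]
  have hst : ‖(σ : ℂ)‖ ≤ ‖t‖ := by rw [hnorm]; exact (hσ.trans_le (min_le_right _ _)).le
  obtain ⟨φ, hφ, hφh⟩ := exists_absConvSubring_tsum_coeff_eq (s := (σ : ℂ))
    (by rw [hnorm]; exact hσ.trans_le (min_le_left _ _)) hh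
  refine ⟨σ, by rwa [hnorm], hst, φ, hφ, ?_⟩
  let X' : absConvSubring (σ : ℂ) := ⟨PowerSeries.X, X_mem_absConvSubring _⟩
  let C' : ℂ → absConvSubring (σ : ℂ) := fun c => ⟨PowerSeries.C c, C_mem_absConvSubring _ c⟩
  let φ' : absConvSubring (σ : ℂ) := ⟨φ, hφ⟩
  let F' : absConvSubring (σ : ℂ) := ⟨F, absConvSubring_anti hst hF⟩
  let P' : absConvSubring (σ : ℂ) := ∏ i, (1 - C' (lam i) * X') ^ mul i
  have hP' : (P' : PowerSeries ℂ) =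
      ∏ i, (1 - PowerSeries.C (lam i) * PowerSeries.X) ^ mul i := by
    simp [P', C', X']
  rw [← hP']
  refine eq_of_eventually_tsum_coeff_eq (t := (σ : ℂ)) (by exact_mod_cast hσ0.ne')
    (φ' * F').2 P'.2 ?_
  have hf0' : ∀ᶠ z in 𝓝 (0 : ℂ), f z ≠ 0 :=
    (hfan 0 (by rw [norm_zero]; linarith)).continuousAt.eventually_ne hf0
  filter_upwards [hf0', hloc 0 _ (hquot 0 (by rw [norm_zero]; linarith) hf0) EventuallyEq.rfl,
    Metric.ball_mem_nhds (0 : ℂ) hσ0] with z hfz hhz hz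
  have hzσ : ‖z‖ ≤ ‖(σ : ℂ)‖ := by rw [hnorm]; exact (mem_ball_zero_iff.1 hz).le
  change ∑' n, PowerSeries.coeff n (φ' * F').1 * z ^ n = _
  rw [← evalAbsConv_apply hzσ (φ' * F'), ← evalAbsConv_apply hzσ P', map_mul, map_prod]
  simp only [map_pow, map_sub, map_one, map_mul, X', C', evalAbsConv_X, evalAbsConv_C]
  rw [evalAbsConv_apply, evalAbsConv_apply]
  simp only [φ', F']
  rw [hfF z (hzσ.trans hst), hφh z (by
    have := mem_ball_zero_iff.1 hz
    have := hσ.trans_le (min_le_left r ‖t‖)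
    linarith), hhz]
  exact div_mul_cancel₀ _ hfz

/-- **Asymptotic Binet formula with multiplicities.**
Let `(A_n)` be a `Fib_p` recurrence whose entry power series `K(i,j) = ∑ A_n(i,j) z^n`
all have radius of convergence at least `ρ` for some `ρ > 1` (i.e. they converge on the
disk `D_ρ`), and let `f(z) = det(I_p − z K(z))` be the holomorphic function on `D_ρ`
defined by the kneading determinant.  Suppose `λ_1, …, λ_m` are pairwise distinct with
`|λ_i| ≥ 1`, the zero set of `f` in the closed unit disk is exactly `{λ_1⁻¹, …, λ_m⁻¹}`,
and `f` has a zero of order `mul i ≥ 1` at each `λ_i⁻¹`.  Then for every solution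
`(v_n)_{n∈ℤ}` of the recurrence (with `v_n = 0` for all but finitely many `n < 0` and
`v_{n+1} = ∑_{i=0}^∞ A_i v_{n−i}` for `n ≥ 0`, the sum having finitely many nonzero
terms) and every component `α`, there are unique constants `c i j` with
`v_n^{(α)} − ∑_i ∑_j c i j · (n+j−1)!/((j−1)!·n!) · λ_i^n → 0`
(here `j : Fin (mul i)` is 0-based, representing the paper's `j + 1`). -/
theorem stmt3 (p : ℕ) (hp : 0 < p) (A : ℕ → Matrix (Fin p) (Fin p) ℂ)
    (ρ : ℝ) (hρ : 1 < ρ)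
    (hconv : ∀ (i j : Fin p) (z : ℂ), ‖z‖ < ρ → Summable fun n : ℕ => A n i j * z ^ n)
    (f : ℂ → ℂ)
    (hf : ∀ z : ℂ, f z =
      Matrix.det (1 - z • Matrix.of fun i j : Fin p => ∑' n : ℕ, A n i j * z ^ n))
    (m : ℕ) (lam : Fin m → ℂ) (hinj : Function.Injective lam)
    (hdom : ∀ i, 1 ≤ ‖lam i‖)
    (hzeros : ∀ z : ℂ, ‖z‖ ≤ 1 → (f z = 0 ↔ ∃ i, z = (lam i)⁻¹))
    (mul : Fin m → ℕ) (hmul : ∀ i, 1 ≤ mul i)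
    (hord : ∀ i, ∃ g : ℂ → ℂ, AnalyticAt ℂ g (lam i)⁻¹ ∧ g (lam i)⁻¹ ≠ 0 ∧
      ∀ᶠ z in nhds (lam i)⁻¹, f z = (z - (lam i)⁻¹) ^ (mul i) * g z)
    (v : ℤ → Fin p → ℂ)
    (hsupp : {n : ℤ | n < 0 ∧ v n ≠ 0}.Finite)
    (hrec : ∀ n : ℕ, v ((n : ℤ) + 1) = ∑' i : ℕ, (A i).mulVec (v ((n : ℤ) - (i : ℤ))))
    (a : Fin p) :
    ∃! c : (i : Fin m) → Fin (mul i) → ℂ,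
      Tendsto (fun n : ℕ =>
          v (n : ℤ) a - ∑ i : Fin m, ∑ j : Fin (mul i),
            c i j * (((n + (j : ℕ)).factorial : ℂ) /
              (((j : ℕ).factorial : ℂ) * (n.factorial : ℂ))) * lam i ^ n)
        atTop (nhds 0) := by
  have hcoeff : ∀ (c : (i : Fin m) → Fin (mul i) → ℂ) (n : ℕ),
      ∑ i : Fin m, ∑ j : Fin (mul i), c i j * (((n + (j : ℕ)).factorial : ℂ) /
        (((j : ℕ).factorial : ℂ) * (n.factorial : ℂ))) * lam i ^ n =
      PowerSeries.coeff n (∑ i, ∑ j : Fin (mul i),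
        PowerSeries.C (c i j) * geomSeries (lam i) ^ ((j : ℕ) + 1)) := by
    intro c n
    simp only [map_sum, PowerSeries.coeff_C_mul, coeff_geomSeries_pow, mul_assoc]
  refine existsUnique_of_exists_of_unique ?_ ?_
  · obtain ⟨τ, hτ1, hτ⟩ := exists_between hρ
    have hnorm : ‖(τ : ℂ)‖ = τ := by
      rw [Complex.norm_real, Real.norm_of_nonneg (by linarith)]
    have hτ0 : (τ : ℂ) ≠ 0 := norm_pos_iff.1 (by linarith)
    obtain ⟨F, hF, hFeval, hFV⟩ := exists_kneadingDeterminant (A := A) hτ0 fun i j => by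
      rw [mem_absConvSubring]
      simpa only [PowerSeries.coeff_mk] using (hconv i j τ (by rwa [hnorm])).norm
    obtain ⟨s, hs, hst, φ, hφ, hφF⟩ := exists_mul_eq_prod_one_sub_pow (by rwa [hnorm]) hF
      (fun z hz => (hFeval z hz).trans (hf z).symm) (by simp [hf]) hdom
      (fun z hz => (hzeros z hz).1) hord
    set S : Multiset ℂ := ∑ i, Multiset.replicate (mul i) (lam i) with hS
    have hSprod : (S.map fun μ => 1 - PowerSeries.C μ * PowerSeries.X).prod =
        ∏ i, (1 - PowerSeries.C (lam i) * PowerSeries.X) ^ mul i := by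
      rw [hS, ← Multiset.coe_mapAddMonoidHom, map_sum, Multiset.prod_sum]
      simp
    have hSmem : ∀ μ ∈ S, ∃ i, lam i = μ := by
      intro μ hμ
      obtain ⟨i, -, hi⟩ := Multiset.mem_sum.1 hμ
      exact ⟨i, (Multiset.eq_of_mem_replicate hi).symm⟩
    have hScount : ∀ i, S.count (lam i) = mul i := by
      intro i
      simp [hS, Multiset.count_sum', Multiset.count_replicate, hinj.eq_iff]
    have hV := mem_principalPartSpace_of_mul_mem (s := S)
      (φ := PowerSeries.mk fun n : ℕ => v n a)
      (by intro μ hμ; obtain ⟨i, rfl⟩ := hSmem μ hμ; exact hdom i)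
      (by
        rw [hSprod, ← hφF, mul_assoc]
        exact mem_overconvergent.2
          ⟨s, hs, mul_mem hφ (absConvSubring_anti hst (hFV v hsupp hrec a))⟩)
    obtain ⟨x, hx, y, hy, hxy⟩ := Submodule.mem_sup.1 hV
    have hx' : x ∈ Submodule.span ℂ (Set.range fun q : Σ i, Fin (mul i) =>
        geomSeries (lam q.1) ^ ((q.2 : ℕ) + 1)) := by
      refine Submodule.span_mono ?_ hx
      rintro _ ⟨μ, j, hj, rfl⟩
      obtain ⟨i, rfl⟩ := hSmem μ (Multiset.count_pos.1 (by omega))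
      rw [hScount] at hj
      exact ⟨⟨i, ⟨j, hj⟩⟩, rfl⟩
    obtain ⟨c, rfl⟩ := (Submodule.mem_span_range_iff_exists_fun ℂ).1 hx'
    refine ⟨fun i j => c ⟨i, j⟩, (tendsto_coeff_of_mem_overconvergent hy).congr fun n => ?_⟩
    rw [hcoeff]
    have := congrArg (PowerSeries.coeff n) hxy
    rw [map_add, PowerSeries.coeff_mk, Fintype.sum_sigma] at this
    simp only [PowerSeries.smul_eq_C_mul] at this
    rw [← this]
    ring
  · intro c d hc hd
    refine sub_eq_zero.1 (eq_zero_of_tendsto_coeff_sum_geomSeries hinj hdom (c - d) ?_)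
    have h := hd.sub hc
    rw [sub_zero] at h
    refine h.congr fun n => ?_
    rw [hcoeff, hcoeff]
    simp only [Pi.sub_apply, map_sub, sub_mul, Finset.sum_sub_distrib]
    ring
end

section
/- Let m, p ≥ 1, let X, Y ∈ ℂ^{m×m}, and let C_1, …, C_p ∈ ℂ^{m×1} and R_1, …, R_p ∈ ℂ^{1×m} satisfy Y − X = C_1 R_1 + ⋯ + C_p R_p. Let R ∈ ℂ^{1×m} and C ∈ ℂ^{m×1} be arbitrary. Define M ∈ ℂ[[z]]^{p×p} by M(i,j) = ∑_{n≥0} (R_i X^n C_j) z^n, and define the extended matrix M_R(C) ∈ ℂ[[z]]^{(p+1)×(p+1)} whose upper-left p×p block is M, whose last column has entries ∑_{n≥0} (R_i X^n C) z^n for i = 1,…,p, whose last row has entries ∑_{n≥0} (R X^n C_j) z^n for j = 1,…,p, and whose bottom-right corner entry is ∑_{n≥0} (R X^n C) z^n. Then det(I_p − zM) · (1 − z·∑_{n≥0} (R Y^n C) z^n) = det(I_{p+1} − zM_R(C)) in ℂ[[z]]; equivalently, since det(I_p − zM) has constant term 1 and hence is invertible in ℂ[[z]], z·∑_{n≥0}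 (R Y^n C) z^n = 1 − det(I_{p+1} − zM_R(C)) / det(I_p − zM). -/
/-- The matrix `M ∈ ℂ[[z]]^{p×p}` with entries `M(i,j) = ∑_{n≥0} (R_i X^n C_j) z^n`. -/
noncomputable def kneadM {m p : ℕ} (X : Matrix (Fin m) (Fin m) ℂ)
    (Cl : Fin p → Matrix (Fin m) (Fin 1) ℂ) (Rw : Fin p → Matrix (Fin 1) (Fin m) ℂ) :
    Matrix (Fin p) (Fin p) (PowerSeries ℂ) :=
  Matrix.of fun i j => PowerSeries.mk fun n => (Rw i * X ^ n * Cl j) 0 0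

/-- The extended matrix `M_R(C) ∈ ℂ[[z]]^{(p+1)×(p+1)}`: its upper-left `p×p` block is `M`,
its last column has entries `∑_{n≥0} (R_i X^n C) z^n`, its last row has entries
`∑_{n≥0} (R X^n C_j) z^n`, and its bottom-right corner entry is `∑_{n≥0} (R X^n C) z^n`. -/
noncomputable def kneadMext {m p : ℕ} (X : Matrix (Fin m) (Fin m) ℂ)
    (Cl : Fin p → Matrix (Fin m) (Fin 1) ℂ) (Rw : Fin p → Matrix (Fin 1) (Fin m) ℂ)
    (Cc : Matrix (Fin m) (Fin 1) ℂ) (Rr : Matrix (Fin 1) (Fin m) ℂ) :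
    Matrix (Fin (p + 1)) (Fin (p + 1)) (PowerSeries ℂ) :=
  Matrix.of fun i j =>
    if hi : (i : ℕ) < p then
      if hj : (j : ℕ) < p then kneadM X Cl Rw ⟨i, hi⟩ ⟨j, hj⟩
      else PowerSeries.mk fun n => (Rw ⟨i, hi⟩ * X ^ n * Cc) 0 0
    else
      if hj : (j : ℕ) < p then PowerSeries.mk fun n => (Rr * X ^ n * Cl ⟨j, hj⟩) 0 0
      else PowerSeries.mk fun n => (Rr * X ^ n * Cc) 0 0

/-- The power series `∑_{n≥0} A^n z^n`, as a matrix of power series, is right inverse to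
`1 - zA`. -/
theorem one_sub_X_smul_map_mul_geom {ι : Type*} [Fintype ι] [DecidableEq ι]
    (A : Matrix ι ι ℂ) :
    (1 - (PowerSeries.X : PowerSeries ℂ) • A.map (PowerSeries.C (R := ℂ))) *
      Matrix.of (fun a b => PowerSeries.mk fun n => (A ^ n) a b) = 1 := by
  ext a b n
  rw [sub_mul, one_mul, Matrix.smul_mul, Matrix.sub_apply, Matrix.smul_apply, smul_eq_mul,
    map_sub, Matrix.of_apply, PowerSeries.coeff_mk]
  cases n with
  | zero =>
    rw [PowerSeries.coeff_zero_X_mul, pow_zero, sub_zero, Matrix.one_apply, Matrix.one_apply]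
    split_ifs <;> simp
  | succ n =>
    rw [PowerSeries.coeff_succ_X_mul, pow_succ', Matrix.mul_apply, Matrix.mul_apply, map_sum,
      Matrix.one_apply]
    simp only [Matrix.map_apply, Matrix.of_apply, PowerSeries.coeff_C_mul,
      PowerSeries.coeff_mk, sub_self]
    split_ifs <;> simp [PowerSeries.coeff_one]

/-- `kneadM` factors through the resolvent series of `X`. -/
theorem kneadM_eq_mul {m p : ℕ} (X : Matrix (Fin m) (Fin m) ℂ)
    (Cl : Fin p → Matrix (Fin m) (Fin 1) ℂ) (Rw : Fin p → Matrix (Fin 1) (Fin m) ℂ) :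
    kneadM X Cl Rw =
      (Matrix.of fun i a => PowerSeries.C (R := ℂ) (Rw i 0 a)) *
        Matrix.of (fun a b => PowerSeries.mk fun n => (X ^ n) a b) *
        (Matrix.of fun a j => PowerSeries.C (R := ℂ) (Cl j a 0)) := by
  ext i j n
  simp [kneadM, Matrix.mul_apply, PowerSeries.coeff_mul_C, PowerSeries.coeff_C_mul]

/-- The determinant of `1 - zM` compares the characteristic series of `X` and of its
finite-rank perturbation `Y`. -/
theorem det_one_sub_X_smul_map_mul_det_kneadM {m p : ℕ} (X Y : Matrix (Fin m) (Fin m) ℂ)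
    (Cl : Fin p → Matrix (Fin m) (Fin 1) ℂ) (Rw : Fin p → Matrix (Fin 1) (Fin m) ℂ)
    (hfr : Y - X = ∑ i : Fin p, Cl i * Rw i) :
    Matrix.det (1 - (PowerSeries.X : PowerSeries ℂ) • X.map (PowerSeries.C (R := ℂ))) *
        Matrix.det (1 - (PowerSeries.X : PowerSeries ℂ) • kneadM X Cl Rw) =
      Matrix.det (1 - (PowerSeries.X : PowerSeries ℂ) • Y.map (PowerSeries.C (R := ℂ))) := by
  have hG := one_sub_X_smul_map_mul_geom X
  set G := Matrix.of (fun a b => PowerSeries.mk fun n => (X ^ n) a b)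
  set V : Matrix (Fin p) (Fin m) (PowerSeries ℂ) :=
    Matrix.of fun i a => PowerSeries.C (R := ℂ) (Rw i 0 a) with hV
  set U : Matrix (Fin m) (Fin p) (PowerSeries ℂ) :=
    Matrix.of fun a j => PowerSeries.C (R := ℂ) (Cl j a 0) with hU
  have hY : Y.map (PowerSeries.C (R := ℂ)) = X.map (PowerSeries.C (R := ℂ)) + U * V := by
    rw [← sub_eq_iff_eq_add']
    ext1 a b
    have h := congrFun (congrFun hfr a) b
    rw [Matrix.sub_apply, Matrix.sum_apply] at h
    simp only [Matrix.sub_apply, Matrix.map_apply, ← map_sub, h]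
    simp [hU, hV, Matrix.mul_apply]
  have hM : (PowerSeries.X : PowerSeries ℂ) • kneadM X Cl Rw =
      V * ((PowerSeries.X : PowerSeries ℂ) • (G * U)) := by
    rw [kneadM_eq_mul, Matrix.mul_smul, Matrix.mul_assoc]
  rw [hM, Matrix.det_one_sub_mul_comm, ← Matrix.det_mul, mul_sub, mul_one, Matrix.smul_mul,
    Matrix.mul_smul, Matrix.mul_assoc G, ← Matrix.mul_assoc _ G, hG, Matrix.one_mul, hY,
    smul_add, sub_sub]

/-- The extended matrix is the matrix `M` of the extended families of columns and rows. -/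
theorem kneadMext_eq_kneadM_snoc {m p : ℕ} (X : Matrix (Fin m) (Fin m) ℂ)
    (Cl : Fin p → Matrix (Fin m) (Fin 1) ℂ) (Rw : Fin p → Matrix (Fin 1) (Fin m) ℂ)
    (Cc : Matrix (Fin m) (Fin 1) ℂ) (Rr : Matrix (Fin 1) (Fin m) ℂ) :
    kneadMext X Cl Rw Cc Rr =
      kneadM X (Fin.snoc (α := fun _ => Matrix (Fin m) (Fin 1) ℂ) Cl Cc)
        (Fin.snoc (α := fun _ => Matrix (Fin 1) (Fin m) ℂ) Rw Rr) := by
  ext1 i j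
  induction i using Fin.lastCases <;> induction j using Fin.lastCases <;>
    simp [kneadMext, kneadM]

/-- A determinant of the form `det (1 - zA)` has constant coefficient `1`. -/
theorem constantCoeff_det_one_sub_X_smul {ι : Type*} [Fintype ι] [DecidableEq ι]
    (A : Matrix ι ι (PowerSeries ℂ)) :
    PowerSeries.constantCoeff (R := ℂ)
      (Matrix.det (1 - (PowerSeries.X : PowerSeries ℂ) • A)) = 1 := by
  rw [RingHom.map_det]
  convert Matrix.det_one (R := ℂ) (n := ι)
  ext i j
  by_cases h : i = j <;> simp [h, Matrix.one_apply]

/-- If `Y − X = C_1 R_1 + ⋯ + C_p R_p` and `R ∈ ℂ^{1×m}`, `C ∈ ℂ^{m×1}` are arbitrary, then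
`det(I_p − zM) · (1 − z ∑_{n≥0} (R Y^n C) z^n) = det(I_{p+1} − zM_R(C))`; equivalently,
since `det(I_p − zM)` has constant term `1` and hence is invertible in `ℂ[[z]]`,
`z ∑_{n≥0} (R Y^n C) z^n = 1 − det(I_{p+1} − zM_R(C)) / det(I_p − zM)`. -/
theorem stmt7 (m p : ℕ) (hm : 1 ≤ m) (hp : 1 ≤ p)
    (X Y : Matrix (Fin m) (Fin m) ℂ)
    (Cl : Fin p → Matrix (Fin m) (Fin 1) ℂ) (Rw : Fin p → Matrix (Fin 1) (Fin m) ℂ)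
    (hfr : Y - X = ∑ i : Fin p, Cl i * Rw i)
    (Cc : Matrix (Fin m) (Fin 1) ℂ) (Rr : Matrix (Fin 1) (Fin m) ℂ) :
    Matrix.det ((1 : Matrix (Fin p) (Fin p) (PowerSeries ℂ)) -
          (PowerSeries.X : PowerSeries ℂ) • kneadM X Cl Rw) *
        (1 - PowerSeries.X * PowerSeries.mk fun n => (Rr * Y ^ n * Cc) 0 0) =
      Matrix.det ((1 : Matrix (Fin (p + 1)) (Fin (p + 1)) (PowerSeries ℂ)) -
          (PowerSeries.X : PowerSeries ℂ) • kneadMext X Cl Rw Cc Rr) ∧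
    PowerSeries.X * PowerSeries.mk (fun n => (Rr * Y ^ n * Cc) 0 0) =
      1 - Matrix.det ((1 : Matrix (Fin (p + 1)) (Fin (p + 1)) (PowerSeries ℂ)) -
            (PowerSeries.X : PowerSeries ℂ) • kneadMext X Cl Rw Cc Rr) *
          (Matrix.det ((1 : Matrix (Fin p) (Fin p) (PowerSeries ℂ)) -
            (PowerSeries.X : PowerSeries ℂ) • kneadM X Cl Rw))⁻¹ := by
  have hc {n : ℕ} (A : Matrix (Fin n) (Fin n) (PowerSeries ℂ)) :
      PowerSeries.constantCoeff (R := ℂ)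
        (Matrix.det (1 - (PowerSeries.X : PowerSeries ℂ) • A)) ≠ 0 := by
    rw [constantCoeff_det_one_sub_X_smul]
    exact one_ne_zero
  have h₁ := det_one_sub_X_smul_map_mul_det_kneadM X Y Cl Rw hfr
  have h₂ := det_one_sub_X_smul_map_mul_det_kneadM X (Y + Cc * Rr)
    (Fin.snoc (α := fun _ => Matrix (Fin m) (Fin 1) ℂ) Cl Cc)
    (Fin.snoc (α := fun _ => Matrix (Fin 1) (Fin m) ℂ) Rw Rr)
    (by simp [Fin.sum_univ_castSucc, ← hfr, add_sub_right_comm])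
  have h₃ := det_one_sub_X_smul_map_mul_det_kneadM Y (Y + Cc * Rr)
    (fun _ : Fin 1 => Cc) (fun _ => Rr) (by simp)
  rw [← kneadMext_eq_kneadM_snoc] at h₂
  have hs : Matrix.det (1 - (PowerSeries.X : PowerSeries ℂ) •
      kneadM Y (fun _ : Fin 1 => Cc) (fun _ => Rr)) =
      1 - PowerSeries.X * PowerSeries.mk fun n => (Rr * Y ^ n * Cc) 0 0 := by
    simp [kneadM]
  rw [hs] at h₃
  have hne : Matrix.det (1 - (PowerSeries.X : PowerSeries ℂ) •
      X.map (PowerSeries.C (R := ℂ))) ≠ 0 := fun h => hc _ (by rw [h, map_zero])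
  have key := mul_left_cancel₀ hne
    ((mul_assoc _ _ _).symm.trans ((congrArg (· * _) h₁).trans (h₃.trans h₂.symm)))
  refine ⟨key, ?_⟩
  rw [← key, mul_right_comm, PowerSeries.mul_inv_cancel _ (hc _), one_mul, sub_sub_cancel]
end

section
/- Consider the Fib_2 recurrence (p = 2) defined by the matrices A_n = (1/n!)·[[−1/(n+1), 2^n], [(−1)^n, 0]] for n ∈ ℕ, and let (v_n)_{n∈ℤ} be its solution with initial condition e_1, i.e., v_0 = (1,0), v_n = 0 for all n < 0, and v_{n+1} = ∑_{i=0}^∞ A_i v_{n−i} for all n ≥ 0. Then the generating functions of the solution satisfy (1 − z²)·E(z)·∑_{n≥0} v_n^{(1)} z^n = 1 and (1 − z²)·E(z)²·∑_{n≥0} v_n^{(2)} z^n = z in ℂ[[z]], where E(z) = ∑_{n≥0} z^n/n! (so E(z)² = E(2z)); that is, G(e_1) = (1/((1−z²)e^z), z/((1−z²)e^{2z})). -/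
/-- The matrices of the example `Fib_2` recurrence:
`A_n = (1/n!)·[[−1/(n+1), 2^n], [(−1)^n, 0]]`. -/
noncomputable def exA (n : ℕ) : Matrix (Fin 2) (Fin 2) ℂ :=
  ((n.factorial : ℂ))⁻¹ • !![-1 / ((n : ℂ) + 1), 2 ^ n; (-1 : ℂ) ^ n, 0]

/-- The exponential formal power series `E(z) = ∑_{n≥0} z^n/n!`. -/
noncomputable def expPS : PowerSeries ℂ :=
  PowerSeries.mk fun n => 1 / (n.factorial : ℂ)

open PowerSeries in
/-- The formal exponential series is the one of Mathlib. -/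
theorem expPS_eq_exp : expPS = PowerSeries.exp ℂ := by
  ext n
  simp [expPS, PowerSeries.coeff_exp]

open PowerSeries in
theorem X_mul_mk_exA_zero_zero : X * mk (fun n => exA n 0 0) = 1 - expPS := by
  ext n
  cases n with
  | zero => simp [expPS]
  | succ n =>
    have h : (n.factorial : ℂ) ≠ 0 := by exact_mod_cast n.factorial_ne_zero
    have h' : (n : ℂ) + 1 ≠ 0 := by exact_mod_cast n.succ_ne_zero
    simp only [coeff_succ_X_mul, coeff_mk, exA, expPS, map_sub, coeff_one, Nat.factorial_succ]
    simp
    field_simp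

open PowerSeries in
theorem mk_exA_zero_one : mk (fun n => exA n 0 1) = expPS ^ 2 := by
  rw [expPS_eq_exp, exp_pow_eq_rescale_exp]
  ext n
  simp [exA, coeff_exp, mul_comm]

open PowerSeries in
theorem expPS_mul_mk_exA_one_zero : expPS * mk (fun n => exA n 1 0) = 1 := by
  have h : mk (fun n => exA n 1 0) = evalNegHom (PowerSeries.exp ℂ) := by
    ext n
    simp [exA, evalNegHom, coeff_exp, mul_comm]
  rw [expPS_eq_exp, h, exp_mul_exp_neg_eq_one]

/-- The recurrence, with the series replaced by its finitely many nonzero terms. -/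
theorem exA_recurrence_apply (v : ℤ → Fin 2 → ℂ) (hneg : ∀ n : ℤ, n < 0 → v n = 0)
    (hrec : ∀ n : ℕ, v ((n : ℤ) + 1) = ∑' i : ℕ, (exA i).mulVec (v ((n : ℤ) - (i : ℤ))))
    (n : ℕ) (α : Fin 2) :
    v ((n : ℤ) + 1) α = ∑ p ∈ Finset.HasAntidiagonal.antidiagonal n, (exA p.1).mulVec (v (p.2 : ℤ)) α := by
  rw [hrec n, tsum_eq_sum (s := Finset.range (n + 1)), Finset.sum_apply,
    Finset.Nat.sum_antidiagonal_eq_sum_range_succ (fun i j => (exA i).mulVec (v (j : ℤ)) α)]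
  · refine Finset.sum_congr rfl fun i hi => ?_
    rw [Nat.cast_sub (Nat.lt_succ_iff.mp (Finset.mem_range.mp hi))]
  · intro i hi
    rw [hneg _ (by simp at hi; omega), Matrix.mulVec_zero]

open PowerSeries in
/-- The linear system satisfied by the generating functions of a solution. -/
theorem mk_exA_solution (v : ℤ → Fin 2 → ℂ) (hneg : ∀ n : ℤ, n < 0 → v n = 0)
    (hrec : ∀ n : ℕ, v ((n : ℤ) + 1) = ∑' i : ℕ, (exA i).mulVec (v ((n : ℤ) - (i : ℤ))))
    (α : Fin 2) :
    mk (fun n => v (n : ℤ) α) = C (v 0 α) +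
      X * (mk (fun n => exA n α 0) * mk (fun n => v (n : ℤ) 0) +
        mk (fun n => exA n α 1) * mk (fun n => v (n : ℤ) 1)) := by
  ext n
  cases n with
  | zero => simp
  | succ n =>
    have h := exA_recurrence_apply v hneg hrec n α
    simp only [Matrix.mulVec, dotProduct, Fin.sum_univ_two, Finset.sum_add_distrib] at h
    rw [map_add, coeff_succ_X_mul]
    simp [coeff_mul, h]

/-- Let `(v_n)_{n∈ℤ}` be the solution of the `Fib_2` recurrence
`A_n = (1/n!)·[[−1/(n+1), 2^n], [(−1)^n, 0]]` with initial condition `e_1`, i.e.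
`v_0 = (1,0)`, `v_n = 0` for `n < 0`, and `v_{n+1} = ∑_{i=0}^∞ A_i v_{n−i}` for `n ≥ 0`
(the sum has only finitely many nonzero terms).  Then its generating functions satisfy
`(1 − z²)·E(z)·∑ v_n^{(1)} z^n = 1` and `(1 − z²)·E(z)²·∑ v_n^{(2)} z^n = z` in `ℂ[[z]]`
(note `E(z)² = E(2z)`); that is, `G(e_1) = (1/((1−z²)e^z), z/((1−z²)e^{2z}))`. -/
theorem stmt12 (v : ℤ → Fin 2 → ℂ)
    (hinit : v 0 = ![1, 0])
    (hneg : ∀ n : ℤ, n < 0 → v n = 0)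
    (hrec : ∀ n : ℕ, v ((n : ℤ) + 1) = ∑' i : ℕ, (exA i).mulVec (v ((n : ℤ) - (i : ℤ)))) :
    (1 - PowerSeries.X ^ 2) * expPS * PowerSeries.mk (fun n => v (n : ℤ) 0) = 1 ∧
    (1 - PowerSeries.X ^ 2) * expPS ^ 2 * PowerSeries.mk (fun n => v (n : ℤ) 1) =
      PowerSeries.X := by
  have h0 := mk_exA_solution v hneg hrec 0
  have h1 := mk_exA_solution v hneg hrec 1
  have hz : PowerSeries.mk (fun n => exA n 1 1) = 0 := by
    ext n
    simp [exA]
  have ha := X_mul_mk_exA_zero_zero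
  have hc := expPS_mul_mk_exA_one_zero
  simp only [hinit, mk_exA_zero_one, hz, Matrix.cons_val_zero, Matrix.cons_val_one, map_one,
    map_zero, zero_mul, add_zero, zero_add] at h0 h1
  set G := PowerSeries.mk (fun n : ℕ => v (n : ℤ) 0)
  set H := PowerSeries.mk (fun n : ℕ => v (n : ℤ) 1)
  set c := PowerSeries.mk (fun n => exA n 1 0)
  have hG : (1 - PowerSeries.X ^ 2) * expPS * G = 1 := by
    linear_combination h0 + G * ha + PowerSeries.X * expPS ^ 2 * h1 +
      PowerSeries.X ^ 2 * expPS * G * hc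
  refine ⟨hG, ?_⟩
  linear_combination (1 - PowerSeries.X ^ 2) * expPS ^ 2 * h1 +
    (1 - PowerSeries.X ^ 2) * PowerSeries.X * expPS * G * hc + PowerSeries.X * hG
end

section
/- Let p ≥ 1 and let (A_n)_{n≥0} be a Fib_p recurrence such that every entry power series K(i,j) = ∑_{n≥0} A_n(i,j) z^n has radius of convergence at least ρ for some ρ > 1, and fix α ∈ {1,…,p} and β ∈ ℤ⁺. Let f(z) = det(I_p − z·K(z)) and f_{α,β}(z) = det(I_{p+1} − z·K_α(β)(z)) be the holomorphic functions on the disk D_ρ = {z ∈ ℂ : |z| < ρ} defined by the kneading and extended kneading determinants (the entries of the last column of K_α(β) also have radius of convergence at least ρ). Then the function h(z) = (f(z) − f_{α,β}(z))/(z·f(z)) is meromorphic on D_ρ, every pole of h in D_ρ is a zero of f, h has a removable singularity at z = 0 (since f(0) − f_{α,β}(0) = 0), and on a neighborhood of 0 the function h equals the sum of the convergent power series ∑_{n≥0} v_n^{(α)} z^n, where (v_n)_{n∈ℤ} = Θ(e_β) is the solution of the recurrence with initial condition e_β. In particular, the generating function G_α(e_β) extends to a meromorphic function on D_ρ whose poles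 lie among the zeros of f. -/
/-- For `β ∈ ℤ⁺` with `β = qp + r` (`q = β / p`, `r = β % p`), the index in `Fin p`
(0-based) of the nonzero coordinate of the standard basis vector `e_β` of
`U = ⊕_{n∈ℕ} ℂ^p`: it is `p` (1-based) if `r = 0` and `r` (1-based) otherwise. -/
def coordIdx (p β : ℕ) (hp : 0 < p) : Fin p :=
  if h : β % p = 0 then ⟨p - 1, by omega⟩
  else ⟨β % p - 1, by have := Nat.mod_lt β hp; omega⟩

/-- The block index (in `ℕ`) of the unique nonzero block of the standard basis vector
`e_β`: it is `q − 1` if `r = 0`, and `q` otherwise, where `β = qp + r`. -/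
def blockIdx (p β : ℕ) : ℕ :=
  if β % p = 0 then β / p - 1 else β / p

/-- The coefficients of the last column of the extended kneading matrix `K_α(β)`:
`K(i,β) = ∑_{n≥0} A_{n+q−1}(i,p) z^n` if `p ∣ β` and `K(i,β) = ∑_{n≥0} A_{n+q}(i,r) z^n`
otherwise. -/
noncomputable def colA (p : ℕ) (A : ℕ → Matrix (Fin p) (Fin p) ℂ) (β : ℕ) (hp : 0 < p)
    (n : ℕ) (i : Fin p) : ℂ :=
  if β % p = 0 then A (n + β / p - 1) i (coordIdx p β hp)
  else A (n + β / p) i (coordIdx p β hp)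

/-- The kneading matrix, evaluated as a matrix-valued function on the disk of convergence:
`K(z)(i,j) = ∑_{n≥0} A_n(i,j) z^n`. -/
noncomputable def kneadFun (p : ℕ) (A : ℕ → Matrix (Fin p) (Fin p) ℂ) (z : ℂ) :
    Matrix (Fin p) (Fin p) ℂ :=
  Matrix.of fun i j => ∑' n : ℕ, A n i j * z ^ n

/-- The extended kneading matrix `K_α(β)`, evaluated as a matrix-valued function:
its upper-left `p×p` block is `K(z)`, its last column is `(∑_n colA_n(i) z^n)_i`, and its
last row is `(δ(α,1), …, δ(α,p), δ(α,β))`.  Here `a : Fin p` is 0-based, representing the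
paper's `α = a + 1`. -/
noncomputable def kneadExtFun (p : ℕ) (A : ℕ → Matrix (Fin p) (Fin p) ℂ) (a : Fin p)
    (β : ℕ) (hp : 0 < p) (z : ℂ) : Matrix (Fin (p + 1)) (Fin (p + 1)) ℂ :=
  Matrix.of fun i j =>
    if hi : (i : ℕ) < p then
      if hj : (j : ℕ) < p then ∑' n : ℕ, A n ⟨i, hi⟩ ⟨j, hj⟩ * z ^ n
      else ∑' n : ℕ, colA p A β hp n ⟨i, hi⟩ * z ^ n
    else
      if hj : (j : ℕ) < p then (if (a : ℕ) = (j : ℕ) then 1 else 0)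
      else (if (a : ℕ) + 1 = β then 1 else 0)

/-- The kneading determinant as a holomorphic function: `f(z) = det(I_p − z·K(z))`. -/
noncomputable def kneadDetFun (p : ℕ) (A : ℕ → Matrix (Fin p) (Fin p) ℂ) (z : ℂ) : ℂ :=
  Matrix.det (1 - z • kneadFun p A z)

/-- The extended kneading determinant as a holomorphic function:
`f_{α,β}(z) = det(I_{p+1} − z·K_α(β)(z))`. -/
noncomputable def kneadExtDetFun (p : ℕ) (A : ℕ → Matrix (Fin p) (Fin p) ℂ) (a : Fin p)
    (β : ℕ) (hp : 0 < p) (z : ℂ) : ℂ :=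
  Matrix.det (1 - z • kneadExtFun p A a β hp z)

theorem analyticAt_tsum_mul_pow {c : ℕ → ℂ} {r : ℝ}
    (hc : ∀ z : ℂ, ‖z‖ < r → Summable fun n : ℕ => c n * z ^ n) {z : ℂ} (hz : ‖z‖ < r) :
    AnalyticAt ℂ (fun w : ℂ => ∑' n : ℕ, c n * w ^ n) z := by
  obtain ⟨s, hzs, hsr⟩ := exists_between hz
  have hs : 0 < s := (norm_nonneg z).trans_lt hzs
  lift s to NNReal using hs.le
  set q := FormalMultilinearSeries.ofScalars ℂ c with hq
  have hrad : (s : ENNReal) ≤ q.radius := by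
    refine q.le_radius_of_tendsto (l := 0) ?_
    have h := (hc (s : ℂ) (by simpa using hsr)).tendsto_atTop_zero.norm
    simpa [hq, FormalMultilinearSeries.ofScalars_norm] using h
  have hpos : 0 < q.radius := lt_of_lt_of_le (by exact_mod_cast hs) hrad
  have hball := q.hasFPowerSeriesOnBall hpos
  have hsum : q.sum = fun w : ℂ => ∑' n : ℕ, c n * w ^ n := by
    funext w
    simp [hq, FormalMultilinearSeries.sum, mul_comm]
  rw [hsum] at hball
  refine hball.analyticAt_of_mem ?_
  refine Metric.eball_subset_eball hrad ?_
  simpa [Metric.mem_eball, edist_zero_right, enorm, ← NNReal.coe_lt_coe] using hzs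

theorem analyticAt_matrix_det {n : Type*} [Fintype n] [DecidableEq n] {M : ℂ → Matrix n n ℂ}
    {z : ℂ} (hM : ∀ i j, AnalyticAt ℂ (fun w => M w i j) z) :
    AnalyticAt ℂ (fun w => (M w).det) z := by
  simp only [Matrix.det_apply']
  exact Finset.analyticAt_fun_sum _ fun σ _ =>
    analyticAt_const.mul (Finset.analyticAt_fun_prod _ fun i _ => hM _ _)

/-- Bordering `N` by the column `-N w` and the row `-r` multiplies the determinant by the
Schur complement `d - r ⬝ w`, whether or not `N` is invertible. -/
theorem det_fromBlocks_neg_mulVec {n R : Type*} [Fintype n] [DecidableEq n] [CommRing R]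
    (N : Matrix n n R) (w r : n → R) (d : R) :
    (Matrix.fromBlocks N (Matrix.replicateCol (Fin 1) (-N.mulVec w))
      (Matrix.replicateRow (Fin 1) (-r)) (Matrix.of fun _ _ => d)).det
      = N.det * (d - r ⬝ᵥ w) := by
  have h : Matrix.fromBlocks N (Matrix.replicateCol (Fin 1) (-N.mulVec w))
      (Matrix.replicateRow (Fin 1) (-r)) (Matrix.of fun _ _ => d) *
      Matrix.fromBlocks 1 (Matrix.replicateCol (Fin 1) w) 0 1 =
      Matrix.fromBlocks N 0 (Matrix.replicateRow (Fin 1) (-r))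
        (Matrix.of fun _ _ => d - r ⬝ᵥ w) := by
    rw [Matrix.fromBlocks_multiply]
    congr 1
    · simp
    · ext i j
      simp [Matrix.mul_apply, Matrix.mulVec, dotProduct]
    · simp
    · ext i j
      simp [Matrix.mul_apply, dotProduct]
      ring
  have h' := congrArg Matrix.det h
  rw [Matrix.det_mul, Matrix.det_fromBlocks_zero₂₁, Matrix.det_fromBlocks_zero₁₂] at h'
  simpa using h'

theorem colA_eq_blockIdx (p : ℕ) (A : ℕ → Matrix (Fin p) (Fin p) ℂ) {β : ℕ} (hp : 0 < p)
    (hβ : 1 ≤ β) (n : ℕ) (i : Fin p) :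
    colA p A β hp n i = A (n + blockIdx p β) i (coordIdx p β hp) := by
  unfold colA blockIdx
  split_ifs with h
  · have : 1 ≤ β / p := Nat.div_pos (Nat.le_of_dvd hβ (Nat.dvd_of_mod_eq_zero h)) hp
    rw [Nat.add_sub_assoc this]
  · rfl

theorem blockIdx_mul_add_coordIdx (p : ℕ) {β : ℕ} (hp : 0 < p) (hβ : 1 ≤ β) :
    p * blockIdx p β + coordIdx p β hp + 1 = β := by
  have hdiv := Nat.div_add_mod β p
  unfold blockIdx coordIdx
  split_ifs with h
  · have h1 : 1 ≤ β / p := Nat.div_pos (Nat.le_of_dvd hβ (Nat.dvd_of_mod_eq_zero h)) hp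
    obtain ⟨q, hq⟩ := Nat.exists_eq_add_of_le' h1
    rw [hq, Nat.mul_add] at hdiv
    rw [hq]
    simp only [Nat.add_sub_cancel]
    omega
  · dsimp only
    omega

theorem initial_coord_eq (p : ℕ) {β : ℕ} (hp : 0 < p) (hβ : 1 ≤ β) (a : Fin p) :
    (if 0 = blockIdx p β then Pi.single (coordIdx p β hp) 1 else 0 : Fin p → ℂ) a =
      if (a : ℕ) + 1 = β then 1 else 0 := by
  have h := blockIdx_mul_add_coordIdx p hp hβ
  have ha := a.isLt
  rcases Nat.eq_zero_or_pos (blockIdx p β) with hb | hb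
  · rw [hb, mul_zero, zero_add] at h
    rw [if_pos hb.symm, Pi.single_apply]
    exact if_congr (by rw [Fin.ext_iff]; omega) rfl rfl
  · have : p ≤ p * blockIdx p β := Nat.le_mul_of_pos_right p hb
    rw [if_neg hb.ne, if_neg (by omega), Pi.zero_apply]

/-- The part of a solution strictly after the initial condition. -/
def solutionTail {E : Type*} [Zero E] (v : ℤ → E) (n : ℕ) : E := if n = 0 then 0 else v n

theorem solutionTail_succ_eq {p β : ℕ} {hp : 0 < p} (hβ : 1 ≤ β)
    {A : ℕ → Matrix (Fin p) (Fin p) ℂ} {v : ℤ → Fin p → ℂ}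
    (hinit : ∀ n : ℕ, v (-(n : ℤ)) =
      (if n = blockIdx p β then Pi.single (coordIdx p β hp) 1 else 0))
    (hrec : ∀ n : ℕ, v ((n : ℤ) + 1) = ∑' i : ℕ, (A i).mulVec (v ((n : ℤ) - (i : ℤ))))
    (n : ℕ) (i : Fin p) :
    solutionTail v (n + 1) i = colA p A β hp n i +
      ∑ kl ∈ Finset.HasAntidiagonal.antidiagonal n, ∑ j, A kl.1 i j * solutionTail v kl.2 j := by
  set b := blockIdx p β
  set c := coordIdx p β hp
  have hsplit : ∀ k : ℕ, (A k).mulVec (v ((n : ℤ) - (k : ℤ))) =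
      (if k = n + b then (A (n + b)).mulVec (Pi.single c 1) else 0) +
      (if k ∈ Finset.range (n + 1) then (A k).mulVec (solutionTail v (n - k)) else 0) := by
    intro k
    rcases lt_or_ge k n with hk | hk
    · have h1 : k ≠ n + b := by omega
      have h2 : n - k ≠ 0 := by omega
      have h3 : (n : ℤ) - k = ((n - k : ℕ) : ℤ) := by omega
      rw [if_neg h1, if_pos (Finset.mem_range.2 (by omega)), zero_add, h3, solutionTail,
        if_neg h2]
    · have h3 : (n : ℤ) - k = -((k - n : ℕ) : ℤ) := by omega
      have h4 : solutionTail v (n - k) = 0 := by simp [solutionTail, Nat.sub_eq_zero_of_le hk]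
      have h5 : k - n = b ↔ k = n + b := by omega
      rw [h3, hinit, h4]
      by_cases h : k = n + b
      · simp [h]
      · simp [mt h5.1 h, h]
  have hs : HasSum (fun k : ℕ => (A k).mulVec (v ((n : ℤ) - (k : ℤ))))
      ((A (n + b)).mulVec (Pi.single c 1) +
        ∑ k ∈ Finset.range (n + 1), (A k).mulVec (solutionTail v (n - k))) := by
    simp only [hsplit]
    refine (hasSum_ite_eq _ _).add ?_
    rw [← Finset.inter_self (Finset.range (n + 1)), ← Finset.sum_ite_mem, Finset.inter_self]
    exact hasSum_sum_of_ne_finset_zero fun k hk => if_neg hk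
  have hv : solutionTail v (n + 1) = v ((n : ℤ) + 1) := by simp [solutionTail]
  rw [hv, hrec, hs.tsum_eq, colA_eq_blockIdx p A hp hβ,
    Finset.Nat.sum_antidiagonal_eq_sum_range_succ_mk]
  simp [Matrix.mulVec, dotProduct, b, c]

/-- A solution of a convolution recurrence with bounded coefficients grows at most
geometrically. -/
theorem norm_le_pow_of_convolution {p : ℕ} {A : ℕ → Matrix (Fin p) (Fin p) ℂ}
    {C u : ℕ → Fin p → ℂ} {M : ℝ} (hM : 0 ≤ M) (hA : ∀ n i j, ‖A n i j‖ ≤ M)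
    (hC : ∀ n i, ‖C n i‖ ≤ M) (hu0 : u 0 = 0)
    (hu : ∀ n i, u (n + 1) i = C n i +
      ∑ kl ∈ Finset.HasAntidiagonal.antidiagonal n, ∑ j, A kl.1 i j * u kl.2 j) (n : ℕ) (i : Fin p) :
    ‖u n i‖ ≤ (1 + p * M) ^ n := by
  have key : ∀ n, 1 + ∑ l ∈ Finset.range (n + 1), ∑ j, ‖u l j‖ ≤ (1 + p * M) ^ n := by
    intro n
    induction n with
    | zero => simp [hu0]
    | succ n ih =>
      have hstep : ∀ i, ‖u (n + 1) i‖ ≤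
          M * (1 + ∑ l ∈ Finset.range (n + 1), ∑ j, ‖u l j‖) := by
        intro i
        rw [hu, mul_add, mul_one]
        refine (norm_add_le _ _).trans (add_le_add (hC n i) ?_)
        rw [← Finset.Nat.sum_antidiagonal_eq_sum_range_succ_mk
          (fun kl : ℕ × ℕ => ∑ j, ‖u kl.1 j‖), ← Finset.Nat.sum_antidiagonal_swap,
          Finset.mul_sum]
        refine (norm_sum_le _ _).trans (Finset.sum_le_sum fun kl _ => ?_)
        rw [Finset.mul_sum]
        refine (norm_sum_le _ _).trans (Finset.sum_le_sum fun j _ => ?_)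
        rw [norm_mul]
        exact mul_le_mul_of_nonneg_right (hA _ _ _) (norm_nonneg _)
      have hrow := Finset.sum_le_sum fun i (_ : i ∈ Finset.univ) => hstep i
      rw [Finset.sum_const, Finset.card_univ, Fintype.card_fin, nsmul_eq_mul] at hrow
      rw [Finset.sum_range_succ, pow_succ]
      have := mul_le_mul_of_nonneg_right ih (by positivity : (0 : ℝ) ≤ 1 + p * M)
      linarith
  have h1 : ‖u n i‖ ≤ ∑ j, ‖u n j‖ :=
    Finset.single_le_sum (f := fun j => ‖u n j‖) (fun _ _ => norm_nonneg _) (Finset.mem_univ i)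
  have h2 : ∑ j, ‖u n j‖ ≤ ∑ l ∈ Finset.range (n + 1), ∑ j, ‖u l j‖ :=
    Finset.single_le_sum (f := fun l => ∑ j, ‖u l j‖)
      (fun _ _ => Finset.sum_nonneg fun _ _ => norm_nonneg _) (Finset.self_mem_range_succ n)
  linarith [key n]

theorem summable_norm_mul_pow_of_norm_le_pow {c : ℕ → ℂ} {R : ℝ} (hR : 0 < R)
    (hc : ∀ n, ‖c n‖ ≤ R ^ n) {z : ℂ} (hz : ‖z‖ < R⁻¹) :
    Summable fun n : ℕ => ‖c n * z ^ n‖ := by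
  have hlt : R * ‖z‖ < 1 := by
    simpa [hR.ne'] using mul_lt_mul_of_pos_left hz hR
  refine Summable.of_nonneg_of_le (fun _ => norm_nonneg _) (fun n => ?_)
    (summable_geometric_of_lt_one (by positivity) hlt)
  rw [norm_mul, norm_pow, mul_pow]
  exact mul_le_mul_of_nonneg_right (hc n) (by positivity)

/-- The generating functions of a convolution recurrence satisfy `W = z (C + K W)`. -/
theorem tsum_eq_of_convolution {p : ℕ} {A : ℕ → Matrix (Fin p) (Fin p) ℂ}
    {C u : ℕ → Fin p → ℂ} (hu0 : u 0 = 0)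
    (hu : ∀ n i, u (n + 1) i = C n i +
      ∑ kl ∈ Finset.HasAntidiagonal.antidiagonal n, ∑ j, A kl.1 i j * u kl.2 j) {z : ℂ}
    (hA : ∀ i j, Summable fun n : ℕ => ‖A n i j * z ^ n‖)
    (hC : ∀ i, Summable fun n : ℕ => C n i * z ^ n)
    (hus : ∀ i, Summable fun n : ℕ => ‖u n i * z ^ n‖) (i : Fin p) :
    ∑' n, u n i * z ^ n = z * (∑' n, C n i * z ^ n +
      ∑ j, (∑' n, A n i j * z ^ n) * ∑' n, u n j * z ^ n) := by
  have hconv : ∀ j, HasSum (fun n => ∑ kl ∈ Finset.HasAntidiagonal.antidiagonal n,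
      (A kl.1 i j * z ^ kl.1) * (u kl.2 j * z ^ kl.2))
      ((∑' n, A n i j * z ^ n) * ∑' n, u n j * z ^ n) := fun j => by
    rw [tsum_mul_tsum_eq_tsum_sum_antidiagonal_of_summable_norm (hA i j) (hus j)]
    exact (summable_norm_sum_mul_antidiagonal_of_summable_norm (hA i j) (hus j)).of_norm.hasSum
  have hsum := ((hC i).hasSum.add (hasSum_sum fun j (_ : j ∈ Finset.univ) => hconv j)).mul_left z
  rw [(hus i).of_norm.tsum_eq_zero_add, ← hsum.tsum_eq]
  simp only [hu0, Pi.zero_apply, zero_mul, zero_add]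
  refine tsum_congr fun n => ?_
  rw [hu, Finset.sum_comm, add_mul, mul_add, pow_succ, Finset.sum_mul, Finset.mul_sum]
  congr 1
  · ring
  · refine Finset.sum_congr rfl fun j _ => ?_
    rw [Finset.sum_mul, Finset.mul_sum]
    refine Finset.sum_congr rfl fun kl hkl => ?_
    rw [← Finset.HasAntidiagonal.mem_antidiagonal.1 hkl, pow_add]
    ring

theorem kneadExtDetFun_eq {p : ℕ} {A : ℕ → Matrix (Fin p) (Fin p) ℂ} {a : Fin p} {β : ℕ}
    {hp : 0 < p} {z : ℂ} {W : Fin p → ℂ}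
    (hW : ∀ i, W i = z * (∑' n, colA p A β hp n i * z ^ n + ∑ j, kneadFun p A z i j * W j)) :
    kneadExtDetFun p A a β hp z =
      kneadDetFun p A z * (1 - z * ((if (a : ℕ) + 1 = β then 1 else 0) + W a)) := by
  have hNW : (1 - z • kneadFun p A z).mulVec W =
      fun i => z * ∑' n, colA p A β hp n i * z ^ n := by
    funext i
    rw [Matrix.sub_mulVec, Matrix.one_mulVec, Matrix.smul_mulVec, Pi.sub_apply, Pi.smul_apply,
      smul_eq_mul, Matrix.mulVec, dotProduct]
    conv_lhs => rw [hW i]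
    ring
  have h := det_fromBlocks_neg_mulVec (1 - z • kneadFun p A z) W (Pi.single a z)
    (1 - z * (if (a : ℕ) + 1 = β then 1 else 0))
  rw [single_dotProduct] at h
  unfold kneadExtDetFun kneadDetFun
  rw [mul_add, ← sub_sub, ← h, hNW,
    ← Matrix.det_submatrix_equiv_self
      (finSumFinEquiv)]
  congr 1
  ext i j
  rcases i with i | i <;> rcases j with j | j
  · simp [kneadExtFun, kneadFun, Matrix.one_apply, Fin.ext_iff]
  · simp [kneadExtFun, Fin.ext_iff, i.isLt.ne]
  · simp [kneadExtFun, Fin.ext_iff, j.isLt.ne', Pi.single_apply, eq_comm]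
  · simp [kneadExtFun, Subsingleton.elim i j]

/-- **The generating function of a solution extends to a meromorphic function.**
Let `(A_n)` be a `Fib_p` recurrence whose entry power series (and the entries of the last
column of the extended kneading matrix `K_α(β)`) have radius of convergence at least `ρ`
for some `ρ > 1`, let `f = det(I − zK(z))` and `f_{α,β} = det(I − zK_α(β)(z))` be the
holomorphic functions on `D_ρ` defined by the kneading and extended kneading
determinants, and let `h(z) = (f(z) − f_{α,β}(z))/(z·f(z))`.  Let `(v_n)_{n∈ℤ} = Θ(e_β)`
be the solution of the recurrence with initial condition `e_β`.  Then `h` is meromorphic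
on `D_ρ`; every pole of `h` in `D_ρ` is a zero of `f` (i.e. `h` is analytic at each
`z ≠ 0` of `D_ρ` with `f z ≠ 0`); `h` has a removable singularity at `0`
(since `f(0) − f_{α,β}(0) = 0`); and on a punctured neighborhood of `0` the function `h`
equals the sum of the convergent power series `∑_{n≥0} v_n^{(α)} z^n`. -/
theorem stmt14 (p : ℕ) (hp : 0 < p) (A : ℕ → Matrix (Fin p) (Fin p) ℂ)
    (β : ℕ) (hβ : 1 ≤ β) (a : Fin p)
    (ρ : ℝ) (hρ : 1 < ρ)
    (hconv : ∀ (i j : Fin p) (z : ℂ), ‖z‖ < ρ → Summable fun n : ℕ => A n i j * z ^ n)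
    (hconvcol : ∀ (i : Fin p) (z : ℂ), ‖z‖ < ρ →
      Summable fun n : ℕ => colA p A β hp n i * z ^ n)
    (v : ℤ → Fin p → ℂ)
    (hinit : ∀ n : ℕ, v (-(n : ℤ)) =
      (if n = blockIdx p β then Pi.single (coordIdx p β hp) 1 else 0))
    (hrec : ∀ n : ℕ, v ((n : ℤ) + 1) = ∑' i : ℕ, (A i).mulVec (v ((n : ℤ) - (i : ℤ)))) :
    MeromorphicOn
      (fun z : ℂ => (kneadDetFun p A z - kneadExtDetFun p A a β hp z) /
        (z * kneadDetFun p A z))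
      {z : ℂ | ‖z‖ < ρ} ∧
    (∀ z : ℂ, ‖z‖ < ρ → z ≠ 0 → kneadDetFun p A z ≠ 0 →
      AnalyticAt ℂ
        (fun z : ℂ => (kneadDetFun p A z - kneadExtDetFun p A a β hp z) /
          (z * kneadDetFun p A z)) z) ∧
    kneadDetFun p A 0 - kneadExtDetFun p A a β hp 0 = 0 ∧
    (∃ h₀ : ℂ → ℂ, AnalyticAt ℂ h₀ 0 ∧
      ∀ᶠ z in nhdsWithin (0 : ℂ) {(0 : ℂ)}ᶜ,
        (kneadDetFun p A z - kneadExtDetFun p A a β hp z) / (z * kneadDetFun p A z) =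
          h₀ z) ∧
    (∃ ε : ℝ, 0 < ε ∧ ∀ z : ℂ, ‖z‖ < ε → z ≠ 0 →
      Summable (fun n : ℕ => v (n : ℤ) a * z ^ n) ∧
      (kneadDetFun p A z - kneadExtDetFun p A a β hp z) / (z * kneadDetFun p A z) =
        ∑' n : ℕ, v (n : ℤ) a * z ^ n) := by
  have hK : ∀ z : ℂ, ‖z‖ < ρ → ∀ i j, AnalyticAt ℂ (fun w => ∑' n : ℕ, A n i j * w ^ n) z :=
    fun z hz i j => analyticAt_tsum_mul_pow (hconv i j) hz
  have hf : ∀ z : ℂ, ‖z‖ < ρ → AnalyticAt ℂ (kneadDetFun p A) z := by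
    intro z hz
    refine analyticAt_matrix_det fun i j => ?_
    simp only [Matrix.sub_apply, Matrix.smul_apply, smul_eq_mul, kneadFun, Matrix.of_apply]
    exact analyticAt_const.sub (analyticAt_id.mul (hK z hz i j))
  have hfe : ∀ z : ℂ, ‖z‖ < ρ → AnalyticAt ℂ (kneadExtDetFun p A a β hp) z := by
    intro z hz
    refine analyticAt_matrix_det fun i j => ?_
    simp only [Matrix.sub_apply, Matrix.smul_apply, smul_eq_mul, kneadExtFun, Matrix.of_apply]
    refine analyticAt_const.sub (analyticAt_id.mul ?_)
    split_ifs
    · exact hK z hz _ _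
    · exact analyticAt_tsum_mul_pow (hconvcol _) hz
    all_goals exact analyticAt_const
  have hnum : ∀ z : ℂ, ‖z‖ < ρ →
      AnalyticAt ℂ (fun z => kneadDetFun p A z - kneadExtDetFun p A a β hp z) z :=
    fun z hz => (hf z hz).sub (hfe z hz)
  have hden : ∀ z : ℂ, ‖z‖ < ρ → AnalyticAt ℂ (fun z => z * kneadDetFun p A z) z :=
    fun z hz => analyticAt_id.mul (hf z hz)
  have hser : ∃ ε : ℝ, 0 < ε ∧ ∀ z : ℂ, ‖z‖ < ε →
      Summable (fun n : ℕ => v (n : ℤ) a * z ^ n) ∧ (z ≠ 0 →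
      (kneadDetFun p A z - kneadExtDetFun p A a β hp z) / (z * kneadDetFun p A z) =
        ∑' n : ℕ, v (n : ℤ) a * z ^ n) := by
    obtain ⟨M, hM, hAM⟩ : ∃ M : ℝ, 0 ≤ M ∧ ∀ n i j, ‖A n i j‖ ≤ M := by
      have hbdd : ∀ i j, ∃ M : ℝ, ∀ n, ‖A n i j‖ ≤ M := fun i j => by
        have h := (hconv i j 1 (by simpa using hρ)).tendsto_atTop_zero.norm.bddAbove_range
        obtain ⟨M, hM⟩ := h
        exact ⟨M, fun n => by simpa using hM ⟨n, rfl⟩⟩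
      choose B hB using hbdd
      refine ⟨∑ i, ∑ j, |B i j|, by positivity, fun n i j => ?_⟩
      refine ((hB i j n).trans (le_abs_self _)).trans ?_
      refine (Finset.single_le_sum (f := fun j => |B i j|) (fun _ _ => abs_nonneg _)
        (Finset.mem_univ j)).trans ?_
      exact Finset.single_le_sum (f := fun i => ∑ j, |B i j|)
        (fun _ _ => Finset.sum_nonneg fun _ _ => abs_nonneg _) (Finset.mem_univ i)
    have hCM : ∀ n i, ‖colA p A β hp n i‖ ≤ M := fun n i => by
      rw [colA_eq_blockIdx p A hp hβ]
      exact hAM _ _ _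
    have hu0 : solutionTail v 0 = 0 := if_pos rfl
    have hu := solutionTail_succ_eq (hp := hp) hβ hinit hrec
    have hR : 0 < 1 + p * M := by positivity
    have hbound := norm_le_pow_of_convolution hM hAM hCM hu0 hu
    have hne : ∀ᶠ z in nhds (0 : ℂ), kneadDetFun p A z ≠ 0 :=
      (hf 0 (by simpa using zero_lt_one.trans hρ)).continuousAt.eventually_ne
        (by simp [kneadDetFun])
    obtain ⟨δ, hδ, hne⟩ := Metric.eventually_nhds_iff.1 hne
    refine ⟨min δ (min (1 + p * M)⁻¹ ρ), by positivity, fun z hz => ?_⟩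
    obtain ⟨hzδ, hz⟩ := lt_min_iff.1 hz
    obtain ⟨hzR, hzρ⟩ := lt_min_iff.1 hz
    have hus : ∀ i, Summable fun n : ℕ => ‖solutionTail v n i * z ^ n‖ := fun i =>
      summable_norm_mul_pow_of_norm_le_pow hR (fun n => hbound n i) hzR
    have hsucc : ∀ n : ℕ, v ((n + 1 : ℕ) : ℤ) a = solutionTail v (n + 1) a := fun n => by
      simp [solutionTail]
    have hsum : Summable fun n : ℕ => v (n : ℤ) a * z ^ n := by
      rw [← summable_nat_add_iff 1]
      simp only [hsucc]
      exact (summable_nat_add_iff (f := fun n => solutionTail v n a * z ^ n) 1).2 (hus a).of_norm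
    refine ⟨hsum, fun hz0 => ?_⟩
    have hfz : kneadDetFun p A z ≠ 0 := hne (by simpa using hzδ)
    have hW := tsum_eq_of_convolution hu0 hu (fun i j => (hconv i j z hzρ).norm)
      (fun i => hconvcol i z hzρ) hus
    have hv0 : v 0 a = if (a : ℕ) + 1 = β then 1 else 0 := by
      rw [← initial_coord_eq p hp hβ, ← hinit 0]
      simp
    rw [kneadExtDetFun_eq hW, div_eq_iff (mul_ne_zero hz0 hfz), hsum.tsum_eq_zero_add,
      (hus a).of_norm.tsum_eq_zero_add]
    simp only [hsucc, hu0, Nat.cast_zero, hv0, Pi.zero_apply]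
    ring
  obtain ⟨ε, hε, hser⟩ := hser
  refine ⟨fun z hz => (hnum z hz).meromorphicAt.div (hden z hz).meromorphicAt,
    fun z hz hz0 hfz => (hnum z hz).div (hden z hz) (mul_ne_zero hz0 hfz),
    by simp [kneadDetFun, kneadExtDetFun],
    ⟨fun z => ∑' n : ℕ, v (n : ℤ) a * z ^ n,
      analyticAt_tsum_mul_pow (fun z hz => (hser z hz).1) (by simpa using hε), ?_⟩,
    ε, hε, fun z hz hz0 => ⟨(hser z hz).1, (hser z hz).2 hz0⟩⟩
  filter_upwards [self_mem_nhdsWithin, mem_nhdsWithin_of_mem_nhds (Metric.ball_mem_nhds 0 hε)]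
    with z hz0 hz
  exact (hser z (by simpa using hz)).2 hz0
end
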